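/- Suppose the delayed mass-action system is a DeCBMAS and the network is a combination of ℓ subnetworks each of which is a 2d sub-DeCBMAS. Let W be a semilocking set of the combined network in Case III with W^{cv} ≠ ∅ and W ∩ S_c = ∅. Then no ω-limit point of any bounded solution with positive initial condition lies on the boundary L_W. -/

import Mathlib

open Finset Filter

variable {n r : ℕ}

/-- Mass-action monomial `x^y = ∏ j, x j ^ y j`. -/
def mono (x : Fin n → ℝ) (y : Fin n → ℕ) : ℝ := ∏ j, x j ^ y j

/-- A (bounded-domain) solution of the delayed mass-action system whose reactions are
those in the index set `R` (with reactant complexes `y`, product complexes `y'`,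
rate constants `k`, delays `τ`, and maximal delay `τm`):
nonnegative, continuous on `[-τm, ∞)`, and satisfying the delay differential equation
`x'(t) = ∑ i ∈ R, k i (x(t-τ i)^{y i} • y' i - x(t)^{y i} • y i)` for `t > 0`. -/
def IsSolutionOn (y y' : Fin r → Fin n → ℕ) (k τ : Fin r → ℝ) (τm : ℝ)
    (R : Finset (Fin r)) (x : ℝ → Fin n → ℝ) : Prop :=
  (∀ t ∈ Set.Ici (-τm), ∀ j, 0 ≤ x t j) ∧
  ContinuousOn x (Set.Ici (-τm)) ∧
  ∀ t > (0 : ℝ), HasDerivAt x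
    (fun j => ∑ i ∈ R, k i * (mono (x (t - τ i)) (y i) * (y' i j : ℝ)
      - mono (x t) (y i) * (y i j : ℝ))) t

/-- A solution of the full delayed mass-action system. -/
def IsSolution (y y' : Fin r → Fin n → ℕ) (k τ : Fin r → ℝ) (τm : ℝ)
    (x : ℝ → Fin n → ℝ) : Prop :=
  IsSolutionOn y y' k τ τm Finset.univ x

/-- Positive initial condition: `x` is strictly positive on `[-τm, 0]`. -/
def PosInit (τm : ℝ) (x : ℝ → Fin n → ℝ) : Prop :=
  ∀ t ∈ Set.Icc (-τm) 0, ∀ j, 0 < x t j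

/-- The solution is bounded on `[-τm, ∞)`. -/
def BoundedSol (τm : ℝ) (x : ℝ → Fin n → ℝ) : Prop :=
  ∃ M : ℝ, ∀ t ∈ Set.Ici (-τm), ‖x t‖ ≤ M

/-- The (sub)system consisting of the reactions in `R` is complex balanced:
there is a positive state `xb` at which, for every complex `η`, the inflow and
outflow rates of `η` coincide. -/
def ComplexBalancedOn (y y' : Fin r → Fin n → ℕ) (k : Fin r → ℝ)
    (R : Finset (Fin r)) : Prop :=
  ∃ xb : Fin n → ℝ, (∀ j, 0 < xb j) ∧ ∀ η : Fin n → ℕ,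
    ∑ i ∈ R.filter (fun i => y i = η), k i * mono xb (y i)
      = ∑ i ∈ R.filter (fun i => y' i = η), k i * mono xb (y i)

/-- `W` is a semilocking set for the reactions in `R`. -/
def Semilocking (y y' : Fin r → Fin n → ℕ) (R : Finset (Fin r)) (W : Set (Fin n)) : Prop :=
  W.Nonempty ∧ ∀ i ∈ R, (∃ j ∈ W, y' i j ≠ 0) → ∃ j ∈ W, y i j ≠ 0

/-- Stoichiometric subspace spanned by the reaction vectors of the reactions in `R`. -/
def stoichOn (y y' : Fin r → Fin n → ℕ) (R : Finset (Fin r)) : Submodule ℝ (Fin n → ℝ) :=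
  Submodule.span ℝ {v | ∃ i ∈ R, v = fun j => (y' i j : ℝ) - (y i j : ℝ)}

/-- `W` is vertex-type w.r.t. the subspace `V`: the only `v ∈ V` vanishing on `W` is `0`. -/
def VertexType (V : Submodule ℝ (Fin n → ℝ)) (W : Set (Fin n)) : Prop :=
  ∀ v ∈ V, (∀ j ∈ W, v j = 0) → v = 0

/-- `W` is facet-type w.r.t. the subspace `V`: the projection of `V` onto the
coordinates outside `W` has dimension `dim V - 1`. -/
def FacetType (V : Submodule ℝ (Fin n → ℝ)) (W : Set (Fin n)) : Prop :=
  Module.finrank ℝ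
      (V.map (LinearMap.funLeft ℝ ℝ (Subtype.val : {j : Fin n // j ∉ W} → Fin n)))
    = Module.finrank ℝ V - 1

/-- The network is a combination of subnetworks with species sets `Sp p` and with
reaction `i` assigned to subnetwork `grp i`. -/
def IsCombination {l : ℕ} (y y' : Fin r → Fin n → ℕ) (Sp : Fin l → Set (Fin n))
    (grp : Fin r → Fin l) : Prop :=
  (∀ j, ∃ p, j ∈ Sp p) ∧ ∀ i j, (y i j ≠ 0 ∨ y' i j ≠ 0) → j ∈ Sp (grp i)

/-- The reaction index set of subnetwork `p`. -/
def Rgrp {l : ℕ} (grp : Fin r → Fin l) (p : Fin l) : Finset (Fin r) :=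
  Finset.univ.filter (fun i => grp i = p)

/-- The set `S_c` of intersecting species. -/
def interSpecies {l : ℕ} (Sp : Fin l → Set (Fin n)) : Set (Fin n) :=
  {j | ∃ p q, p ≠ q ∧ j ∈ Sp p ∧ j ∈ Sp q}

/-- `W^{cn}`: species outside `W` lying in some subnetwork `p'` with `W ∩ S^(p') = ∅`. -/
def Wcn {l : ℕ} (Sp : Fin l → Set (Fin n)) (W : Set (Fin n)) : Set (Fin n) :=
  {j | j ∉ W ∧ ∃ p, W ∩ Sp p = ∅ ∧ j ∈ Sp p}

/-- `W^{tf}`: completely unrestricted species outside `W`: they occur in some reaction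
all of whose species lie outside `W`. -/
def Wtf (y y' : Fin r → Fin n → ℕ) (W : Set (Fin n)) : Set (Fin n) :=
  {j | j ∉ W ∧ ∃ i, (y i j ≠ 0 ∨ y' i j ≠ 0) ∧
    ∀ j', (y i j' ≠ 0 ∨ y' i j' ≠ 0) → j' ∉ W}

/-- `W^{tr}`: totally restricted species outside `W`: every stoichiometric vector
vanishing on `W` also vanishes at `j`. -/
def Wtr (y y' : Fin r → Fin n → ℕ) (W : Set (Fin n)) : Set (Fin n) :=
  {j | j ∉ W ∧ ∀ v ∈ stoichOn y y' Finset.univ, (∀ j' ∈ W, v j' = 0) → v j = 0}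

/-- `θ` (a function on `[-τm,0]`) is an ω-limit point of the solution `x`. -/
def OmegaLimitPt (τm : ℝ) (x θ : ℝ → Fin n → ℝ) : Prop :=
  ContinuousOn θ (Set.Icc (-τm) 0) ∧ (∀ s ∈ Set.Icc (-τm) 0, ∀ j, 0 ≤ θ s j) ∧
  ∃ tN : ℕ → ℝ, Tendsto tN atTop atTop ∧
    ∀ ε > (0 : ℝ), ∃ N₀, ∀ N ≥ N₀, ∀ s ∈ Set.Icc (-τm) 0, ‖x (tN N + s) - θ s‖ < ε

/-- `θ` lies on the boundary `L_W`: it vanishes identically on the coordinates of `W`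
and is nowhere zero on the coordinates outside `W`. -/
def OnBoundary (τm : ℝ) (W : Set (Fin n)) (θ : ℝ → Fin n → ℝ) : Prop :=
  (∀ s ∈ Set.Icc (-τm) 0, ∀ j ∈ W, θ s j = 0) ∧
  ∀ s ∈ Set.Icc (-τm) 0, ∀ j ∉ W, θ s j ≠ 0

/-- Persistence of the delayed mass-action system: every bounded solution with
positive initial condition has `liminf_{t→∞} x_j(t) > 0` for every species `j`. -/
def Persistent (y y' : Fin r → Fin n → ℕ) (k τ : Fin r → ℝ) (τm : ℝ) : Prop :=
  ∀ x : ℝ → Fin n → ℝ, IsSolution y y' k τ τm x → PosInit τm x → BoundedSol τm x →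
    ∀ j, 0 < liminf (fun t => x t j) atTop


namespace DPf

noncomputable section

open Real

def phi (a : ℝ) : ℝ := a * log a - a
def gg (a b : ℝ) : ℝ := a * (log a - log b) - a + b

structure Sys (n r : ℕ) where
  y : Fin r → Fin n → ℕ
  y' : Fin r → Fin n → ℕ
  κ : Fin r → ℝ
  τ : Fin r → ℝ
  c : Fin n → ℝ
  τm : ℝ
  T0 : ℝ
  M : ℝ
  ξ : ℝ → Fin n → ℝ
  W : Finset (Fin n)
  RW : Finset (Fin r)
  Lam : Fin n → Fin n → ℝ
  hκ : ∀ i, 0 < κ i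
  hτ0 : ∀ i, 0 ≤ τ i
  hτm : ∀ i, τ i ≤ τm
  hτm0 : 0 ≤ τm
  hc : ∀ j, 0 < c j
  hM : 1 ≤ M
  cont : ∀ j, Continuous (fun t => ξ t j)
  pos : ∀ t j, 0 < ξ t j
  bdd : ∀ t j, ξ t j ≤ M
  dde : ∀ t > T0, ∀ j, HasDerivAt (fun t => ξ t j)
    ((∑ i, κ i * (mono (ξ (t - τ i)) (y i) * (y' i j : ℝ)
      - mono (ξ t) (y i) * (y i j : ℝ))) / c j) t
  cb : ∀ f : (Fin n → ℕ) → ℝ, ∑ i, κ i * f (y i) = ∑ i, κ i * f (y' i)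
  Wne : W.Nonempty
  R0y : ∀ i, i ∉ RW → ∀ j ∈ W, y i j = 0
  R0y' : ∀ i, i ∉ RW → ∀ j ∈ W, y' i j = 0
  RWy : ∀ i ∈ RW, ∃ j ∈ W, y i j ≠ 0
  RWy' : ∀ i ∈ RW, ∃ j ∈ W, y' i j ≠ 0
  hLam : ∀ i ∈ RW, ∀ j, ((y' i j : ℝ) - y i j) = ∑ j' ∈ W, Lam j j' * ((y' i j' : ℝ) - y i j')

/-! elementary lemmas -/

lemma gg_ge {a b : ℝ} (ha : 0 < a) (hb : 0 < b) : (√a - √b) ^ 2 ≤ gg a b := by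
  have hsa : 0 < √a := sqrt_pos.2 ha
  have hsb : 0 < √b := sqrt_pos.2 hb
  have h := log_le_sub_one_of_pos (div_pos hsb hsa)
  rw [log_div hsb.ne' hsa.ne', log_sqrt ha.le, log_sqrt hb.le] at h
  have h2 : √a ^ 2 * (√b / √a - 1) = √a * √b - √a ^ 2 := by field_simp
  have h3 := mul_le_mul_of_nonneg_left h (sq_nonneg (√a))
  rw [h2] at h3
  have ea := sq_sqrt ha.le
  have eb := sq_sqrt hb.le
  unfold gg
  rw [ea] at h3
  nlinarith

lemma gg_nonneg {a b : ℝ} (ha : 0 < a) (hb : 0 < b) : 0 ≤ gg a b :=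
  (sq_nonneg _).trans (gg_ge ha hb)

lemma sub_sq_le {a b B : ℝ} (ha : 0 < a) (hb : 0 < b) (hA : a ≤ B) (hB : b ≤ B) :
    (a - b) ^ 2 ≤ 4 * B * gg a b := by
  have h1 := gg_ge ha hb
  have ea := sq_sqrt ha.le
  have eb := sq_sqrt hb.le
  have h2 : (a - b) ^ 2 = (√a + √b) ^ 2 * (√a - √b) ^ 2 := by
    rw [← mul_pow, ← ea, ← eb]; simp only [sqrt_sq (sqrt_nonneg _)]; ring
  have h3 : (√a + √b) ^ 2 ≤ 4 * B := by nlinarith [sq_nonneg (√a - √b)]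
  rw [h2]
  exact mul_le_mul h3 h1 (sq_nonneg _) (by linarith)

lemma phi_ge {a : ℝ} (ha : 0 < a) : -2 * √a ≤ phi a := by
  have h := gg_ge ha one_pos
  have ea := sq_sqrt ha.le
  unfold gg at h
  simp at h
  unfold phi
  nlinarith

lemma phi_nonpos {a : ℝ} (ha : 0 < a) (h1 : a ≤ 1) : phi a ≤ 0 := by
  have := log_nonpos ha.le h1
  unfold phi; nlinarith

lemma phi_cont : Continuous phi := by
  unfold phi; exact (continuous_mul_log).sub continuous_id

lemma phi_deriv {a : ℝ} (ha : 0 < a) : HasDerivAt phi (log a) a := by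
  have h : HasDerivAt (fun a : ℝ => a * log a - a) (log a + 1 - 1) a :=
    (hasDerivAt_mul_log ha.ne').sub (hasDerivAt_id a)
  rw [add_sub_cancel_right] at h
  exact h

/-- lower tangent -/
lemma phi_tan {a : ℝ} (m : ℝ) (ha : 0 < a) : m * a - exp m ≤ phi a := by
  have h := gg_nonneg ha (exp_pos m)
  unfold gg at h; rw [log_exp] at h; unfold phi; nlinarith

lemma exp_sub_le {p m K : ℝ} (hp : p ≤ K) (hm : m ≤ K) :
    |exp p - exp m| ≤ exp K * |p - m| := by
  wlog h : m ≤ p generalizing p m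
  · rw [abs_sub_comm, abs_sub_comm p m]; exact this hm hp (by linarith)
  rw [abs_of_nonneg (by linarith [exp_le_exp.2 h]), abs_of_nonneg (by linarith)]
  have h1 : exp p * (m - p + 1) ≤ exp m := by
    have := mul_le_mul_of_nonneg_left (add_one_le_exp (m - p)) (exp_pos p).le
    rwa [← exp_add, add_sub_cancel] at this
  have h2 := mul_le_mul_of_nonneg_right (exp_le_exp.2 hp) (sub_nonneg.2 h)
  nlinarith

lemma phi_up {a m K : ℝ} (ha : 0 < a) (hp : log a ≤ K) (hm : |m| ≤ K) :
    phi a ≤ m * a - exp m + exp (3 * K) * (log a - m) ^ 2 := by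
  have hm' := abs_le.1 hm
  have h1 : a * (log a - m) - a + exp m ≤ (a - exp m) ^ 2 * exp (-m) := by
    have h := log_le_sub_one_of_pos (mul_pos ha (exp_pos (-m)))
    rw [log_mul ha.ne' (exp_pos _).ne', log_exp] at h
    have h3 := mul_le_mul_of_nonneg_left h ha.le
    have e : exp m * exp (-m) = 1 := by rw [← exp_add]; simp
    have : (a - exp m) ^ 2 * exp (-m) = a * (a * exp (-m)) - 2 * a * (exp m * exp (-m)) + exp m * (exp m * exp (-m)) := by ring
    rw [this, e]; nlinarith
  have h2 := exp_sub_le hp hm'.2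
  rw [exp_log ha] at h2
  have h3 : (a - exp m) ^ 2 ≤ (exp K) ^ 2 * (log a - m) ^ 2 := by
    rw [← mul_pow, ← sq_abs (a - exp m), ← sq_abs (exp K * _), abs_mul, abs_of_pos (exp_pos K)]
    gcongr
  have h4 : exp (-m) ≤ exp K := exp_le_exp.2 (by linarith)
  have h5 : (a - exp m) ^ 2 * exp (-m) ≤ exp (3 * K) * (log a - m) ^ 2 := by
    calc _ ≤ ((exp K) ^ 2 * (log a - m) ^ 2) * exp K := by gcongr
      _ = exp (3 * K) * (log a - m) ^ 2 := by
        rw [show 3 * K = K + K + K by ring, exp_add, exp_add]; ring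
  unfold phi; nlinarith

lemma log_sub_le {a b d : ℝ} (hd : 0 < d) (ha : d ≤ a) (hb : d ≤ b) :
    |log a - log b| ≤ |a - b| / d := by
  have ha0 := hd.trans_le ha
  have hb0 := hd.trans_le hb
  wlog h : b ≤ a generalizing a b
  · rw [abs_sub_comm, abs_sub_comm a b]; exact this hb ha hb0 ha0 (by linarith)
  rw [abs_of_nonneg (by linarith [log_le_log hb0 h]), abs_of_nonneg (by linarith)]
  have := log_le_sub_one_of_pos (div_pos ha0 hb0)
  rw [log_div ha0.ne' hb0.ne'] at this
  have e : a / b - 1 = (a - b) / b := by field_simp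
  rw [e] at this
  refine this.trans ?_
  have : 0 ≤ a - b := by linarith
  gcongr

lemma deriv_window {f : ℝ → ℝ} (hf : Continuous f) (a t : ℝ) :
    HasDerivAt (fun t => ∫ s in (t - a)..t, f s) (f t - f (t - a)) t := by
  have hF : ∀ t, HasDerivAt (fun t => ∫ s in (0:ℝ)..t, f s) (f t) t := fun t =>
    intervalIntegral.integral_hasDerivAt_right (hf.intervalIntegrable _ _)
      (hf.stronglyMeasurableAtFilter _ _) hf.continuousAt
  have h2 : HasDerivAt (fun t => ∫ s in (0:ℝ)..(t - a), f s) (f (t - a)) t := by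
    have := (hF (t - a)).comp t ((hasDerivAt_id t).sub_const a)
    rw [mul_one] at this
    exact this
  refine ((hF t).sub h2).congr_of_eventuallyEq (Filter.Eventually.of_forall fun s => ?_)
  exact (intervalIntegral.integral_interval_sub_left (hf.intervalIntegrable _ _)
    (hf.intervalIntegrable _ _)).symm

lemma log_mono {x : Fin n → ℝ} (hx : ∀ j, 0 < x j) (η : Fin n → ℕ) :
    log (mono x η) = ∑ j, (η j : ℝ) * log (x j) := by
  unfold mono
  rw [log_prod (fun j _ => (pow_pos (hx j) _).ne')]
  simp

lemma mono_pos {x : Fin n → ℝ} (hx : ∀ j, 0 < x j) (η : Fin n → ℕ) : 0 < mono x η :=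
  Finset.prod_pos fun j _ => pow_pos (hx j) _

/-- mono ≤ K * x j when η j ≠ 0 -/
lemma mono_le_bd (M : ℝ) (hM : 1 ≤ M) (η : Fin n → ℕ) :
    ∃ B : ℝ, 1 ≤ B ∧ ∀ x : Fin n → ℝ, (∀ j, 0 < x j) → (∀ j, x j ≤ M) → mono x η ≤ B ∧
      ∀ j, η j ≠ 0 → mono x η ≤ B * x j := by
  refine ⟨M ^ (∑ j, η j), one_le_pow₀ hM, fun x hx hb => ⟨?_, fun j hj => ?_⟩⟩
  · unfold mono
    rw [← Finset.prod_pow_eq_pow_sum]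
    exact Finset.prod_le_prod (fun j _ => (pow_pos (hx j) _).le)
      (fun j _ => pow_le_pow_left₀ (hx j).le (hb j) _)
  · unfold mono
    rw [← Finset.prod_pow_eq_pow_sum, ← Finset.mul_prod_erase _ _ (Finset.mem_univ j),
      ← Finset.mul_prod_erase _ (fun i => M ^ η i) (Finset.mem_univ j)]
    have h1 : ∏ i ∈ univ.erase j, x i ^ η i ≤ ∏ i ∈ univ.erase j, M ^ η i :=
      Finset.prod_le_prod (fun j _ => (pow_pos (hx j) _).le)
        (fun j _ => pow_le_pow_left₀ (hx j).le (hb j) _)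
    have h2 : x j ^ η j ≤ M ^ η j * x j := by
      obtain ⟨k, hk⟩ := Nat.exists_eq_succ_of_ne_zero hj
      rw [hk, pow_succ]
      have : x j ^ k ≤ M ^ (k+1) :=
        (pow_le_pow_left₀ (hx j).le (hb j) _).trans (pow_le_pow_right₀ hM (by omega))
      exact mul_le_mul_of_nonneg_right this (hx j).le
    calc _ ≤ (M ^ η j * x j) * ∏ i ∈ univ.erase j, M ^ η i := by
          apply mul_le_mul h2 h1 (Finset.prod_nonneg fun i _ => (pow_pos (hx i) _).le)
          exact mul_nonneg (by positivity) (hx j).le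
      _ = _ := by ring

namespace Sys

variable (S : Sys n r)

def u (i : Fin r) (t : ℝ) : ℝ := mono (S.ξ t) (S.y i)
def v (i : Fin r) (t : ℝ) : ℝ := mono (S.ξ t) (S.y' i)
def J (i : Fin r) (t : ℝ) : ℝ := ∫ s in (t - S.τ i)..t, S.u i s
def H (i : Fin r) (t : ℝ) : ℝ := ∫ s in (t - S.τ i)..t, phi (S.u i s)
def V (t : ℝ) : ℝ := ∑ j, S.c j * phi (S.ξ t j) + ∑ i, S.κ i * S.H i t
def Sd (t : ℝ) : ℝ := ∑ i, S.κ i * gg (S.u i (t - S.τ i)) (S.v i t)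
def ep (t : ℝ) : ℝ := ∑ j ∈ S.W, S.ξ t j
def z (j : Fin n) (t : ℝ) : ℝ := S.c j * S.ξ t j + ∑ i, S.κ i * S.J i t * S.y' i j
def L : ℝ := S.τm + 1
/-- right-hand side contribution of reaction `i` to species `j` -/
def rt (i : Fin r) (j : Fin n) (t : ℝ) : ℝ :=
  S.κ i * (S.u i (t - S.τ i) * (S.y' i j : ℝ) - S.u i t * (S.y i j : ℝ))

lemma L_pos : 0 < S.L := by have := S.hτm0; unfold L; linarith
lemma L_ge : 1 ≤ S.L := by have := S.hτm0; unfold L; linarith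

lemma u_pos (i t) : 0 < S.u i t := mono_pos (S.pos t) _
lemma v_pos (i t) : 0 < S.v i t := mono_pos (S.pos t) _
lemma u_cont (i) : Continuous (S.u i) := by
  unfold u mono
  exact continuous_finsetProd _ fun j _ => (S.cont j).pow _
lemma ep_pos (t) : 0 < S.ep t := Finset.sum_pos (fun j _ => S.pos t j) S.Wne
lemma log_u (i t) : log (S.u i t) = ∑ j, (S.y i j : ℝ) * log (S.ξ t j) := log_mono (S.pos t) _
lemma log_v (i t) : log (S.v i t) = ∑ j, (S.y' i j : ℝ) * log (S.ξ t j) := log_mono (S.pos t) _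

lemma exB : ∃ B : ℝ, 1 ≤ B ∧ ∀ i t, S.u i t ≤ B ∧ S.v i t ≤ B ∧
    ∀ j, S.y i j ≠ 0 → S.u i t ≤ B * S.ξ t j := by
  choose B hB1 hB using fun i => mono_le_bd S.M S.hM (S.y i)
  choose B' hB1' hB' using fun i => mono_le_bd S.M S.hM (S.y' i)
  have hs : ∀ i, B i + B' i ≤ ∑ i, (B i + B' i) := fun i =>
    Finset.single_le_sum (f := fun i => B i + B' i)
      (fun i _ => by have := hB1 i; have := hB1' i; linarith) (Finset.mem_univ i)
  have h0 : 0 ≤ ∑ i, (B i + B' i) :=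
    Finset.sum_nonneg (fun i _ => by have := hB1 i; have := hB1' i; linarith)
  refine ⟨1 + ∑ i, (B i + B' i), by linarith, fun i t => ?_⟩
  have h1 := hB i (S.ξ t) (S.pos t) (S.bdd t)
  have h2 := hB' i (S.ξ t) (S.pos t) (S.bdd t)
  have h3 := hs i
  have h4 := hB1 i
  have h5 := hB1' i
  refine ⟨?_, ?_, fun j hj => (h1.2 j hj).trans ?_⟩
  · have := h1.1; unfold u; linarith
  · have := h2.1; unfold v; linarith
  · exact mul_le_mul_of_nonneg_right (by linarith) (S.pos t j).le

lemma x_deriv {t : ℝ} (ht : S.T0 < t) (j : Fin n) :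
    HasDerivAt (fun t => S.ξ t j) ((∑ i, S.rt i j t) / S.c j) t := S.dde t ht j

lemma J_deriv (i t) : HasDerivAt (S.J i) (S.u i t - S.u i (t - S.τ i)) t :=
  deriv_window (S.u_cont i) _ _
lemma H_deriv (i t) : HasDerivAt (S.H i) (phi (S.u i t) - phi (S.u i (t - S.τ i))) t :=
  deriv_window (phi_cont.comp (S.u_cont i)) _ _

lemma meets_y (i) : (∃ j ∈ S.W, S.y i j ≠ 0) ↔ i ∈ S.RW := by
  constructor
  · rintro ⟨j, hj, h⟩
    by_contra hi
    exact h (S.R0y i hi j hj)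
  · exact S.RWy i
lemma meets_y' (i) : (∃ j ∈ S.W, S.y' i j ≠ 0) ↔ i ∈ S.RW := by
  constructor
  · rintro ⟨j, hj, h⟩
    by_contra hi
    exact h (S.R0y' i hi j hj)
  · exact S.RWy' i

open Classical in
lemma cbRW (f : (Fin n → ℕ) → ℝ) :
    ∑ i ∈ S.RW, S.κ i * f (S.y i) = ∑ i ∈ S.RW, S.κ i * f (S.y' i) := by
  have h := S.cb (fun η => if ∃ j ∈ S.W, η j ≠ 0 then f η else 0)
  simp only [S.meets_y, S.meets_y', mul_ite, mul_zero] at h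
  simpa [Finset.sum_ite_mem] using h

/-- entropy identity -/
lemma entropy (R : Finset (Fin r)) (t : ℝ)
    (hR : ∑ i ∈ R, S.κ i * S.u i t = ∑ i ∈ R, S.κ i * S.v i t) :
    ∑ j, log (S.ξ t j) * ∑ i ∈ R, S.rt i j t
      + ∑ i ∈ R, S.κ i * (phi (S.u i t) - phi (S.u i (t - S.τ i)))
      = - ∑ i ∈ R, S.κ i * gg (S.u i (t - S.τ i)) (S.v i t) := by
  have h1 : ∑ j, log (S.ξ t j) * ∑ i ∈ R, S.rt i j t
      = ∑ i ∈ R, S.κ i * (S.u i (t - S.τ i) * log (S.v i t) - S.u i t * log (S.u i t)) := by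
    simp_rw [Finset.mul_sum]
    rw [Finset.sum_comm]
    refine Finset.sum_congr rfl fun i _ => ?_
    rw [S.log_u, S.log_v, Finset.mul_sum, Finset.mul_sum, ← Finset.sum_sub_distrib, Finset.mul_sum]
    refine Finset.sum_congr rfl fun j _ => ?_
    unfold rt; ring
  rw [h1, ← Finset.sum_add_distrib, ← Finset.sum_neg_distrib]
  have h2 : ∀ i ∈ R, S.κ i * (S.u i (t - S.τ i) * log (S.v i t) - S.u i t * log (S.u i t))
      + S.κ i * (phi (S.u i t) - phi (S.u i (t - S.τ i)))
      = -(S.κ i * gg (S.u i (t - S.τ i)) (S.v i t)) + (S.κ i * S.v i t - S.κ i * S.u i t) := by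
    intro i _; unfold phi gg; ring
  rw [Finset.sum_congr rfl h2, Finset.sum_add_distrib, Finset.sum_sub_distrib, hR]
  ring

lemma cphi_deriv {t : ℝ} (ht : S.T0 < t) (j : Fin n) :
    HasDerivAt (fun t => S.c j * phi (S.ξ t j)) (log (S.ξ t j) * ∑ i, S.rt i j t) t := by
  have h := ((phi_deriv (S.pos t j)).comp t (S.x_deriv ht j)).const_mul (S.c j)
  have := (S.hc j).ne'
  refine HasDerivAt.congr_deriv (f := fun t => S.c j * phi (S.ξ t j)) h ?_
  field_simp

lemma V_deriv {t : ℝ} (ht : S.T0 < t) : HasDerivAt S.V (- S.Sd t) t := by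
  have h1 : HasDerivAt (fun t => ∑ j, S.c j * phi (S.ξ t j))
      (∑ j, log (S.ξ t j) * ∑ i, S.rt i j t) t :=
    HasDerivAt.fun_sum fun j _ => S.cphi_deriv ht j
  have h2 : HasDerivAt (fun t => ∑ i, S.κ i * S.H i t)
      (∑ i, S.κ i * (phi (S.u i t) - phi (S.u i (t - S.τ i)))) t :=
    HasDerivAt.fun_sum fun i _ => (S.H_deriv i t).const_mul _
  have h3 := h1.add h2
  rw [S.entropy Finset.univ t (S.cb (fun η => mono (S.ξ t) η))] at h3
  exact h3

lemma Sd_nonneg (t) : 0 ≤ S.Sd t :=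
  Finset.sum_nonneg fun i _ => mul_nonneg (S.hκ i).le (gg_nonneg (S.u_pos _ _) (S.v_pos _ _))

lemma gg_le (i t) : S.κ i * gg (S.u i (t - S.τ i)) (S.v i t) ≤ S.Sd t :=
  Finset.single_le_sum (f := fun i => S.κ i * gg (S.u i (t - S.τ i)) (S.v i t))
    (fun i _ => mul_nonneg (S.hκ i).le (gg_nonneg (S.u_pos _ _) (S.v_pos _ _))) (Finset.mem_univ i)

lemma exUV : ∃ C : ℝ, 0 < C ∧ ∀ i t, |S.u i (t - S.τ i) - S.v i t| ≤ C * √(S.Sd t) := by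
  obtain ⟨B, hB1, hB⟩ := S.exB
  have key : ∀ i t, |S.u i (t - S.τ i) - S.v i t| ≤ √(4 * B / S.κ i) * √(S.Sd t) := by
    intro i t
    have h := sub_sq_le (S.u_pos i (t - S.τ i)) (S.v_pos i t) (hB i _).1 (hB i _).2.1
    rw [← Real.sqrt_mul (by have := S.hκ i; positivity)]
    apply Real.abs_le_sqrt
    refine h.trans ?_
    have h2 := S.gg_le i t
    have hk := S.hκ i
    rw [div_mul_eq_mul_div, le_div_iff₀ hk]
    nlinarith
  refine ⟨1 + ∑ i, √(4 * B / S.κ i), by positivity, fun i t => (key i t).trans ?_⟩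
  have : √(4 * B / S.κ i) ≤ ∑ i, √(4 * B / S.κ i) :=
    Finset.single_le_sum (f := fun i => √(4 * B / S.κ i)) (fun i _ => sqrt_nonneg _) (Finset.mem_univ i)
  exact mul_le_mul_of_nonneg_right (by linarith) (sqrt_nonneg _)

/-- derivative bounded by the root of dissipation -/
lemma exXd : ∃ C : ℝ, 0 < C ∧ ∀ t j, |(∑ i, S.rt i j t) / S.c j| ≤ C * √(S.Sd t) := by
  obtain ⟨C, hC, h⟩ := S.exUV
  have key : ∀ t j, |(∑ i, S.rt i j t) / S.c j| ≤ (∑ i, S.κ i * C * S.y' i j) / S.c j * √(S.Sd t) := by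
    intro t j
    have e : ∑ i, S.rt i j t = ∑ i, S.κ i * ((S.u i (t - S.τ i) - S.v i t) * S.y' i j) := by
      have h1 := S.cb (fun η => mono (S.ξ t) η * η j)
      have h2 : ∑ i, S.rt i j t = ∑ i, S.κ i * (S.u i (t - S.τ i) * S.y' i j)
          - ∑ i, S.κ i * (S.u i t * S.y i j) := by
        rw [← Finset.sum_sub_distrib]; refine Finset.sum_congr rfl fun i _ => ?_
        unfold rt; ring
      rw [h2]; unfold u at *; rw [h1, ← Finset.sum_sub_distrib]
      refine Finset.sum_congr rfl fun i _ => ?_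
      unfold v; ring
    rw [abs_div, abs_of_pos (S.hc j), div_mul_eq_mul_div, Finset.sum_mul]
    refine div_le_div_of_nonneg_right ?_ (S.hc j).le
    rw [e]
    refine (Finset.abs_sum_le_sum_abs _ _).trans (Finset.sum_le_sum fun i _ => ?_)
    rw [abs_mul, abs_mul, abs_of_pos (S.hκ i), Nat.abs_cast]
    have := mul_le_mul_of_nonneg_left (mul_le_mul_of_nonneg_right (h i t) (Nat.cast_nonneg (S.y' i j) : (0:ℝ) ≤ _)) (S.hκ i).le
    linarith
  have hn : ∀ j, 0 ≤ (∑ i, S.κ i * C * S.y' i j) / S.c j := fun j =>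
    div_nonneg (Finset.sum_nonneg fun i _ => by have := S.hκ i; positivity) (S.hc j).le
  refine ⟨1 + ∑ j, (∑ i, S.κ i * C * S.y' i j) / S.c j,
    by have := Finset.sum_nonneg (fun j (_ : j ∈ univ) => hn j); linarith, fun t j => (key t j).trans ?_⟩
  have := Finset.single_le_sum (f := fun j => (∑ i, S.κ i * C * S.y' i j) / S.c j) (fun j _ => hn j) (Finset.mem_univ j)
  exact mul_le_mul_of_nonneg_right (by linarith) (sqrt_nonneg _)

lemma V_anti {a b : ℝ} (ha : S.T0 < a) (hab : a ≤ b) : S.V b ≤ S.V a := by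
  have : AntitoneOn S.V (Set.Ioi S.T0) := by
    apply antitoneOn_of_deriv_nonpos (convex_Ioi _)
    · exact fun t ht => (S.V_deriv ht).continuousAt.continuousWithinAt
    · rw [interior_Ioi]; exact fun t ht => (S.V_deriv ht).differentiableAt.differentiableWithinAt
    · rw [interior_Ioi]; intro t ht; rw [(S.V_deriv ht).deriv]; have := S.Sd_nonneg t; linarith
  exact this ha (ha.trans_le hab : S.T0 < b) hab

lemma V_bdd : ∃ C : ℝ, ∀ t, C ≤ S.V t := by
  have hphi : ∀ a : ℝ, 0 < a → -1 ≤ phi a := fun a ha => by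
    have := phi_tan 0 ha; simp at this; exact this
  refine ⟨∑ j, S.c j * (-1) + ∑ i, S.κ i * (S.τ i * (-1)), fun t => ?_⟩
  unfold V
  refine add_le_add (Finset.sum_le_sum fun j _ => ?_) (Finset.sum_le_sum fun i _ => ?_)
  · exact mul_le_mul_of_nonneg_left (hphi _ (S.pos _ _)) (S.hc j).le
  · refine mul_le_mul_of_nonneg_left ?_ (S.hκ i).le
    have h := intervalIntegral.integral_mono_on (μ := MeasureTheory.volume) (a := t - S.τ i) (b := t) (f := fun _ => (-1:ℝ))
      (g := fun s => phi (S.u i s)) (by have := S.hτ0 i; linarith)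
      (continuous_const.intervalIntegrable _ _)
      ((phi_cont.comp (S.u_cont i)).intervalIntegrable _ _) (fun s _ => hphi _ (S.u_pos _ _))
    simp only [intervalIntegral.integral_const, smul_eq_mul] at h
    unfold H; linarith

/-- Lemma L -/
lemma step {f f' : ℝ → ℝ} {a b C E : ℝ} (hC : 0 ≤ C) (ha : S.T0 < a) (hab : a ≤ b) (hE : 0 < E)
    (hf : ∀ t ∈ Set.Icc a b, HasDerivAt f (f' t) t) (hf' : ∀ t ∈ Set.Icc a b, f' t ≤ C * √(S.Sd t))
    (hV : S.V a - S.V b ≤ E ^ 2) : f b - f a ≤ C * (1 + (b - a)) * E := by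
  have hd : ∀ t ∈ Set.Icc a b, HasDerivAt (fun t => f t + C / E * S.V t - C * E * t)
      (f' t + C / E * (- S.Sd t) - C * E * 1) t := fun t ht =>
    ((hf t ht).add ((S.V_deriv (ha.trans_le ht.1)).const_mul _)).sub ((hasDerivAt_id t).const_mul _)
  have hanti : AntitoneOn (fun t => f t + C / E * S.V t - C * E * t) (Set.Icc a b) := by
    apply antitoneOn_of_deriv_nonpos (convex_Icc _ _)
    · exact fun t ht => (hd t ht).continuousAt.continuousWithinAt
    · exact fun t ht => (hd t (interior_subset ht)).differentiableAt.differentiableWithinAt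
    · intro t ht
      rw [(hd t (interior_subset ht)).deriv]
      have h1 := hf' t (interior_subset ht)
      have h2 := S.Sd_nonneg t
      have h3 : √(S.Sd t) ≤ S.Sd t / E + E := by
        rw [div_add' _ _ _ hE.ne', le_div_iff₀ hE]
        nlinarith [sq_sqrt h2, sq_nonneg (√(S.Sd t) - E), sqrt_nonneg (S.Sd t), sq_nonneg (√(S.Sd t)), sq_nonneg E]
      have h4 := mul_le_mul_of_nonneg_left h3 hC
      have h5 : C / E * (- S.Sd t) = - (C * (S.Sd t / E)) := by ring
      rw [h5]; linarith
  have h := hanti (Set.left_mem_Icc.2 hab) (Set.right_mem_Icc.2 hab) hab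
  simp only at h
  have h1 : C / E * (S.V a - S.V b) ≤ C / E * E ^ 2 := mul_le_mul_of_nonneg_left hV (by positivity)
  have h2 : C / E * E ^ 2 = C * E := by field_simp
  linarith

/-- displacement -/
lemma exDisp : ∃ C : ℝ, 0 < C ∧ ∀ a b E : ℝ, S.T0 < a → a ≤ b → 0 < E → S.V a - S.V b ≤ E ^ 2 →
    ∀ s ∈ Set.Icc a b, ∀ s' ∈ Set.Icc a b, ∀ j, |S.ξ s j - S.ξ s' j| ≤ C * (1 + (b - a)) * E := by
  obtain ⟨C, hC, h⟩ := S.exXd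
  refine ⟨C, hC, fun a b E ha hab hE hV s hs s' hs' j => ?_⟩
  wlog hss : s ≤ s' generalizing s s'
  · rw [abs_sub_comm]; exact this s' hs' s hs (by linarith)
  have hsT : S.T0 < s := ha.trans_le hs.1
  have hV' : S.V s - S.V s' ≤ E ^ 2 := by
    have h1 := S.V_anti ha hs.1
    have h2 := S.V_anti (ha.trans_le hs'.1) hs'.2
    linarith
  have hmon : C * (1 + (s' - s)) * E ≤ C * (1 + (b - a)) * E := by
    have := hs.1; have := hs'.2
    gcongr
  refine le_trans ?_ hmon
  rw [abs_le]
  constructor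
  · have := S.step (f := fun t => S.ξ t j) hC.le hsT hss hE
      (fun t ht => S.x_deriv (hsT.trans_le ht.1) j) (fun t ht => (le_abs_self _).trans (h t j)) hV'
    linarith
  · have := S.step (f := fun t => - S.ξ t j) hC.le hsT hss hE
      (fun t ht => (S.x_deriv (hsT.trans_le ht.1) j).neg) (fun t ht => (neg_le_abs _).trans (h t j)) hV'
    linarith

/-- backward comparability -/
lemma exBack : ∃ C : ℝ, 1 ≤ C ∧ ∀ s t, S.T0 < s → s ≤ t → t ≤ s + S.L → ∀ j, S.ξ s j ≤ C * S.ξ t j := by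
  obtain ⟨B, hB1, hB⟩ := S.exB
  have hn : ∀ j, 0 ≤ (∑ i, S.κ i * B * S.y i j) / S.c j := fun j =>
    div_nonneg (Finset.sum_nonneg fun i _ => by have := S.hκ i; positivity) (S.hc j).le
  set K := ∑ j, (∑ i, S.κ i * B * S.y i j) / S.c j with hK
  have hK0 : 0 ≤ K := Finset.sum_nonneg fun j _ => hn j
  have hd : ∀ t j, - (K * S.ξ t j) ≤ (∑ i, S.rt i j t) / S.c j := by
    intro t j
    have h1 : - ((∑ i, S.κ i * B * S.y i j) * S.ξ t j) ≤ ∑ i, S.rt i j t := by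
      rw [Finset.sum_mul, ← Finset.sum_neg_distrib]
      refine Finset.sum_le_sum fun i _ => ?_
      unfold rt
      have hk := S.hκ i
      have h2 : S.u i t * S.y i j ≤ B * S.ξ t j * S.y i j := by
        by_cases h0 : S.y i j = 0
        · simp [h0]
        · exact mul_le_mul_of_nonneg_right ((hB i t).2.2 j h0) (Nat.cast_nonneg _)
      have h3 : 0 ≤ S.u i (t - S.τ i) * S.y' i j := mul_nonneg (S.u_pos _ _).le (Nat.cast_nonneg _)
      nlinarith
    have h2 : (∑ i, S.κ i * B * S.y i j) / S.c j ≤ K :=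
      Finset.single_le_sum (f := fun j => (∑ i, S.κ i * B * S.y i j) / S.c j) (fun j _ => hn j) (Finset.mem_univ j)
    have h3 := div_le_div_of_nonneg_right h1 (S.hc j).le
    have h4 := mul_le_mul_of_nonneg_right h2 (S.pos t j).le
    have h5 : -((∑ i, S.κ i * B * S.y i j) * S.ξ t j) / S.c j = -((∑ i, S.κ i * B * S.y i j) / S.c j * S.ξ t j) := by ring
    rw [h5] at h3
    linarith
  refine ⟨exp (K * S.L), one_le_exp (mul_nonneg hK0 S.L_pos.le), fun s t hs hst htL j => ?_⟩
  have hder : ∀ t ∈ Set.Ioi S.T0, HasDerivAt (fun t => exp (K * t) * S.ξ t j)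
      (exp (K * t) * (K * 1) * S.ξ t j + exp (K * t) * ((∑ i, S.rt i j t) / S.c j)) t := fun t ht =>
    (((hasDerivAt_id t).const_mul K).exp).mul (S.x_deriv ht j)
  have hmono : MonotoneOn (fun t => exp (K * t) * S.ξ t j) (Set.Ioi S.T0) := by
    apply monotoneOn_of_deriv_nonneg (convex_Ioi _)
    · exact fun t ht => (hder t ht).continuousAt.continuousWithinAt
    · rw [interior_Ioi]; exact fun t ht => (hder t ht).differentiableAt.differentiableWithinAt
    · rw [interior_Ioi]; intro t ht; rw [(hder t ht).deriv]
      have := hd t j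
      have h2 := exp_pos (K * t)
      nlinarith
  have h := hmono hs (hs.trans_le hst : S.T0 < t) hst
  simp only at h
  have h1 : exp (K * t) ≤ exp (K * S.L) * exp (K * s) := by
    rw [← exp_add]; apply exp_le_exp.2; nlinarith
  have h2 : exp (K * s) * S.ξ s j ≤ exp (K * s) * (exp (K * S.L) * S.ξ t j) := by
    refine h.trans ((mul_le_mul_of_nonneg_right h1 (S.pos t j).le).trans (le_of_eq (by ring)))
  exact le_of_mul_le_mul_left h2 (exp_pos _)

lemma exE : ∃ C : ℝ, 1 ≤ C ∧ ∀ t, S.T0 + S.L < t →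
    (∀ i ∈ S.RW, ∀ s ∈ Set.Icc (t - S.L) t, S.u i s ≤ C * S.ep t) ∧
    (∀ i ∈ S.RW, 0 ≤ S.J i t ∧ S.J i t ≤ C * S.ep t) ∧
    (∀ j ∈ S.W, |S.z j t| ≤ C * S.ep t) := by
  obtain ⟨B, hB1, hB⟩ := S.exB
  obtain ⟨D, hD1, hD⟩ := S.exBack
  have hL := S.L_ge
  have hτm0 := S.hτm0
  set C1 := B * D with hC1
  have hC11 : 1 ≤ C1 := by nlinarith
  set C2 := C1 * S.L with hC2
  have hC21 : C1 ≤ C2 := by nlinarith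
  set C3 := ∑ j, (S.c j + ∑ i, S.κ i * C2 * S.y' i j) with hC3
  have hn : ∀ j, 0 ≤ S.c j + ∑ i, S.κ i * C2 * S.y' i j := fun j =>
    add_nonneg (S.hc j).le (Finset.sum_nonneg fun i _ => by have := S.hκ i; positivity)
  have hC30 : 0 ≤ C3 := Finset.sum_nonneg fun j _ => hn j
  have hep : ∀ t j, j ∈ S.W → S.ξ t j ≤ S.ep t := fun t j hj =>
    Finset.single_le_sum (f := fun j => S.ξ t j) (fun j _ => (S.pos t j).le) hj
  have hu : ∀ t, S.T0 + S.L < t → ∀ i ∈ S.RW, ∀ s ∈ Set.Icc (t - S.L) t, S.u i s ≤ C1 * S.ep t := by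
    intro t ht i hi s hs
    obtain ⟨j, hj, hy⟩ := S.RWy i hi
    have h1 := (hB i s).2.2 j hy
    have h2 := hD s t (by linarith [hs.1]) hs.2 (by linarith [hs.1]) j
    have h3 := hep t j hj
    calc _ ≤ B * S.ξ s j := h1
      _ ≤ B * (D * S.ep t) := by gcongr; exact h2.trans (by gcongr)
      _ = _ := by rw [hC1]; ring
  have hJ : ∀ t, S.T0 + S.L < t → ∀ i ∈ S.RW, 0 ≤ S.J i t ∧ S.J i t ≤ C2 * S.ep t := by
    intro t ht i hi
    have hτ := S.hτ0 i
    have hτ' := S.hτm i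
    constructor
    · exact intervalIntegral.integral_nonneg (by linarith) fun s _ => (S.u_pos i s).le
    · have h := intervalIntegral.integral_mono_on (μ := MeasureTheory.volume) (a := t - S.τ i) (b := t) (f := S.u i)
        (g := fun _ => C1 * S.ep t) (by linarith) ((S.u_cont i).intervalIntegrable _ _)
        (continuous_const.intervalIntegrable _ _) (fun s hs => hu t ht i hi s ⟨by unfold L; linarith [hs.1], hs.2⟩)
      simp only [intervalIntegral.integral_const, smul_eq_mul] at h
      have h0 : 0 ≤ C1 * S.ep t := mul_nonneg (by linarith) (S.ep_pos t).le
      calc _ ≤ _ := h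
        _ ≤ S.L * (C1 * S.ep t) := by gcongr; unfold L; linarith
        _ = _ := by rw [hC2]; ring
  refine ⟨C2 + C3, by linarith, fun t ht => ⟨fun i hi s hs => (hu t ht i hi s hs).trans ?_,
    fun i hi => ⟨(hJ t ht i hi).1, (hJ t ht i hi).2.trans ?_⟩, fun j hj => ?_⟩⟩
  · exact mul_le_mul_of_nonneg_right (by linarith) (S.ep_pos t).le
  · exact mul_le_mul_of_nonneg_right (by linarith) (S.ep_pos t).le
  · have hterm : ∀ i, 0 ≤ S.κ i * S.J i t * S.y' i j ∧
        S.κ i * S.J i t * S.y' i j ≤ S.κ i * C2 * S.y' i j * S.ep t := by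
      intro i
      by_cases hi : i ∈ S.RW
      · have h1 := hJ t ht i hi
        have hk := S.hκ i
        refine ⟨mul_nonneg (mul_nonneg hk.le h1.1) (Nat.cast_nonneg _), ?_⟩
        calc _ ≤ S.κ i * (C2 * S.ep t) * S.y' i j := by gcongr; exact h1.2
          _ = _ := by ring
      · simp [S.R0y' i hi j hj]
    unfold z
    rw [abs_of_nonneg (add_nonneg (mul_nonneg (S.hc j).le (S.pos t j).le) (Finset.sum_nonneg fun i _ => (hterm i).1))]
    have h1 : ∑ i, S.κ i * S.J i t * S.y' i j ≤ (∑ i, S.κ i * C2 * S.y' i j) * S.ep t := by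
      rw [Finset.sum_mul]; exact Finset.sum_le_sum fun i _ => (hterm i).2
    have h2 : S.c j * S.ξ t j ≤ S.c j * S.ep t := mul_le_mul_of_nonneg_left (hep t j hj) (S.hc j).le
    have h3 : S.c j + ∑ i, S.κ i * C2 * S.y' i j ≤ C3 :=
      Finset.single_le_sum (f := fun j => S.c j + ∑ i, S.κ i * C2 * S.y' i j) (fun j _ => hn j) (Finset.mem_univ j)
    have h4 := mul_le_mul_of_nonneg_right h3 (S.ep_pos t).le
    have h5 : 0 ≤ C2 * S.ep t := mul_nonneg (by linarith) (S.ep_pos t).le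
    linarith

def WV (t : ℝ) : ℝ := ∑ j ∈ S.W, S.c j * phi (S.ξ t j) + ∑ i ∈ S.RW, S.κ i * S.H i t

lemma WV_lower : ∃ C : ℝ, 0 < C ∧ ∀ t, S.T0 + S.L < t → -(C * √(S.ep t)) ≤ S.WV t := by
  obtain ⟨C, hC1, hC⟩ := S.exE
  refine ⟨∑ j ∈ S.W, S.c j * 2 + ∑ i ∈ S.RW, S.κ i * (S.τ i * (2 * √C)), ?_, fun t ht => ?_⟩
  · refine add_pos_of_pos_of_nonneg (Finset.sum_pos (fun j _ => by have := S.hc j; positivity) S.Wne)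
      (Finset.sum_nonneg fun i _ => ?_)
    have := S.hκ i; have := S.hτ0 i; positivity
  · rw [add_mul, neg_add, Finset.sum_mul, Finset.sum_mul, ← Finset.sum_neg_distrib, ← Finset.sum_neg_distrib]
    unfold WV
    refine add_le_add (Finset.sum_le_sum fun j hj => ?_) (Finset.sum_le_sum fun i hi => ?_)
    · have h1 := phi_ge (S.pos t j)
      have h2 : √(S.ξ t j) ≤ √(S.ep t) := sqrt_le_sqrt
        (Finset.single_le_sum (f := fun j => S.ξ t j) (fun j _ => (S.pos t j).le) hj)
      have h3 := S.hc j
      nlinarith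
    · have hτ := S.hτ0 i
      have hτ' := S.hτm i
      have h := intervalIntegral.integral_mono_on (μ := MeasureTheory.volume) (a := t - S.τ i) (b := t) (g := fun s => phi (S.u i s))
        (f := fun _ => -2 * √(C * S.ep t)) (by linarith)
        (continuous_const.intervalIntegrable _ _) ((phi_cont.comp (S.u_cont i)).intervalIntegrable _ _)
        (fun s hs => ?_)
      · simp only [intervalIntegral.integral_const, smul_eq_mul, sub_sub_cancel] at h
        rw [sqrt_mul (by linarith)] at h
        have h2 := mul_le_mul_of_nonneg_left h (S.hκ i).le
        unfold H
        refine le_trans (le_of_eq ?_) h2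
        ring
      · have h1 := phi_ge (S.u_pos i s)
        have h2 := sqrt_le_sqrt ((hC t ht).1 i hi s ⟨by unfold L; linarith [hs.1], hs.2⟩)
        linarith

lemma WV_upper (K : ℝ) : ∃ ε : ℝ, 0 < ε ∧ ∀ t, S.T0 + S.L < t → S.ep t ≤ ε → S.WV t ≤ -(K * S.ep t) := by
  obtain ⟨C, hC1, hC⟩ := S.exE
  have hC0 : 0 < C := by linarith
  refine ⟨exp (-∑ j, |K| / S.c j) / C, by positivity, fun t ht he => ?_⟩
  have hsum0 : 0 ≤ ∑ j, |K| / S.c j := Finset.sum_nonneg fun j _ => div_nonneg (abs_nonneg _) (S.hc j).le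
  have he1 : C * S.ep t ≤ exp (-∑ j, |K| / S.c j) := by rw [le_div_iff₀ hC0] at he; linarith
  have he2 : exp (-∑ j, |K| / S.c j) ≤ 1 := exp_le_one_iff.2 (by linarith)
  have hH : ∑ i ∈ S.RW, S.κ i * S.H i t ≤ 0 := by
    refine Finset.sum_nonpos fun i hi => mul_nonpos_of_nonneg_of_nonpos (S.hκ i).le ?_
    have hτ := S.hτ0 i
    have hτ' := S.hτm i
    have h := intervalIntegral.integral_mono_on (μ := MeasureTheory.volume) (a := t - S.τ i) (b := t) (f := fun s => phi (S.u i s))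
        (g := fun _ => 0) (by linarith) ((phi_cont.comp (S.u_cont i)).intervalIntegrable _ _)
        (continuous_const.intervalIntegrable _ _)
        (fun s hs => phi_nonpos (S.u_pos i s) (((hC t ht).1 i hi s ⟨by unfold L; linarith [hs.1], hs.2⟩).trans (he1.trans he2)))
    rw [intervalIntegral.integral_zero] at h
    exact h
  have hW : ∑ j ∈ S.W, S.c j * phi (S.ξ t j) ≤ ∑ j ∈ S.W, -(K * S.ξ t j) := by
    refine Finset.sum_le_sum fun j hj => ?_
    have h1 : S.ξ t j ≤ S.ep t :=
      Finset.single_le_sum (f := fun j => S.ξ t j) (fun j _ => (S.pos t j).le) hj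
    have h2 : S.ξ t j ≤ exp (-∑ j, |K| / S.c j) := by
      have := S.ep_pos t
      nlinarith
    have h3 := log_le_log (S.pos t j) h2
    rw [log_exp] at h3
    have h4 : |K| / S.c j ≤ ∑ j, |K| / S.c j :=
      Finset.single_le_sum (f := fun j => |K| / S.c j) (fun j _ => div_nonneg (abs_nonneg _) (S.hc j).le) (Finset.mem_univ j)
    have h5 : log (S.ξ t j) - 1 ≤ -(|K| / S.c j) := by linarith
    have h6 := mul_le_mul_of_nonneg_left h5 (mul_pos (S.hc j) (S.pos t j)).le
    have h7 : S.c j * S.ξ t j * (-(|K| / S.c j)) = -(|K| * S.ξ t j) := by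
      have := (S.hc j).ne'; field_simp
    rw [h7] at h6
    have h8 := mul_le_mul_of_nonneg_right (le_abs_self K) (S.pos t j).le
    unfold phi; linarith
  unfold WV
  rw [Finset.sum_neg_distrib, ← Finset.mul_sum] at hW
  unfold ep
  linarith

lemma z_deriv {t : ℝ} (ht : S.T0 < t) (j : Fin n) :
    HasDerivAt (S.z j) (∑ i, S.κ i * S.u i t * ((S.y' i j : ℝ) - S.y i j)) t := by
  have h1 := (S.x_deriv ht j).const_mul (S.c j)
  have h2 : HasDerivAt (fun t => ∑ i, S.κ i * S.J i t * S.y' i j)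
      (∑ i, S.κ i * (S.u i t - S.u i (t - S.τ i)) * S.y' i j) t :=
    HasDerivAt.fun_sum fun i _ => ((S.J_deriv i t).const_mul _).mul_const _
  refine HasDerivAt.congr_deriv (f := S.z j) (h1.add h2) ?_
  rw [mul_div_cancel₀ _ (S.hc j).ne', ← Finset.sum_add_distrib]
  refine Finset.sum_congr rfl fun i _ => ?_
  unfold rt; ring

lemma z_sub {t t' : ℝ} (ht : S.T0 < t) (ht' : S.T0 < t') (j : Fin n) :
    S.z j t - S.z j t' = ∑ i, S.κ i * (∫ s in t'..t, S.u i s) * ((S.y' i j : ℝ) - S.y i j) := by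
  have hint : ∀ i, IntervalIntegrable (fun s => S.κ i * S.u i s * ((S.y' i j : ℝ) - S.y i j))
      MeasureTheory.volume t' t := fun i =>
    ((continuous_const.mul (S.u_cont i)).mul continuous_const).intervalIntegrable _ _
  have h := intervalIntegral.integral_eq_sub_of_hasDerivAt (a := t') (b := t) (f := S.z j)
    (f' := fun t => ∑ i, S.κ i * S.u i t * ((S.y' i j : ℝ) - S.y i j))
    (fun s hs => S.z_deriv (lt_of_lt_of_le (lt_min ht' ht) hs.1) j)
    (Continuous.intervalIntegrable (continuous_finsetSum _ fun i _ =>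
      (continuous_const.mul (S.u_cont i)).mul continuous_const) _ _)
  rw [← h, intervalIntegral.integral_finsetSum (fun i _ => hint i)]
  refine Finset.sum_congr rfl fun i _ => ?_
  rw [intervalIntegral.integral_mul_const, intervalIntegral.integral_const_mul]

lemma sum_RW_of {f : Fin r → ℝ} (h : ∀ i, i ∉ S.RW → f i = 0) : ∑ i, f i = ∑ i ∈ S.RW, f i :=
  (Finset.sum_subset (Finset.subset_univ _) (fun i _ hi => h i hi)).symm

lemma w0 {i : Fin r} (hi : i ∉ S.RW) {j : Fin n} (hj : j ∈ S.W) : ((S.y' i j : ℝ) - S.y i j) = 0 := by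
  simp [S.R0y i hi j hj, S.R0y' i hi j hj]

lemma lam_sum (α : Fin r → ℝ) (j : Fin n) :
    ∑ i ∈ S.RW, α i * ((S.y' i j : ℝ) - S.y i j)
      = ∑ j' ∈ S.W, S.Lam j j' * ∑ i, α i * ((S.y' i j' : ℝ) - S.y i j') := by
  have h : ∀ j' ∈ S.W, S.Lam j j' * ∑ i, α i * ((S.y' i j' : ℝ) - S.y i j')
      = ∑ i ∈ S.RW, α i * (S.Lam j j' * ((S.y' i j' : ℝ) - S.y i j')) := by
    intro j' hj'
    rw [S.sum_RW_of (fun i hi => by rw [S.w0 hi hj', mul_zero]), Finset.mul_sum]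
    exact Finset.sum_congr rfl fun i _ => by ring
  rw [Finset.sum_congr rfl h, Finset.sum_comm]
  refine Finset.sum_congr rfl fun i hi => ?_
  rw [S.hLam i hi j, Finset.mul_sum]

open Classical in
/-- linear comparison -/
lemma exLin (K : ℝ) (hK : 0 ≤ K) : ∃ C : ℝ, 0 < C ∧ ∀ t t', S.T0 + S.L < t → S.T0 + S.L < t' →
    ∀ m : Fin n → ℝ, (∀ j ∈ S.W, m j = 0) → (∀ j, |m j| ≤ K) →
    (∀ i, i ∉ S.RW → ∑ j, m j * ((S.y' i j : ℝ) - S.y i j) = 0) →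
    ∑ j ∈ S.Wᶜ, S.c j * (m j * (S.ξ t j - S.ξ t' j)) +
      ∑ i ∈ S.RWᶜ, S.κ i * ((∑ j, (S.y i j : ℝ) * m j) * (S.J i t - S.J i t'))
      ≤ C * (S.ep t + S.ep t') := by
  obtain ⟨D, hD1, hD⟩ := S.exE
  set A := ∑ j, ∑ j' ∈ S.W, K * |S.Lam j j'| * D with hA
  set A2 := ∑ i ∈ S.RW, S.κ i * (D * ∑ j, (S.y' i j : ℝ) * K) with hA2
  have hA0 : 0 ≤ A := Finset.sum_nonneg fun j _ => Finset.sum_nonneg fun j' _ => by positivity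
  have hA20 : 0 ≤ A2 := Finset.sum_nonneg fun i _ => by have := S.hκ i; positivity
  refine ⟨1 + A + A2, by linarith, fun t t' ht ht' m hm0 hmK hm => ?_⟩
  have hL := S.L_pos
  have htT : S.T0 < t := by linarith
  have htT' : S.T0 < t' := by linarith
  -- rewrite the sums
  have e1 : ∑ j ∈ S.Wᶜ, S.c j * (m j * (S.ξ t j - S.ξ t' j)) = ∑ j, S.c j * (m j * (S.ξ t j - S.ξ t' j)) := by
    refine Finset.sum_subset (Finset.subset_univ _) fun j _ hj => ?_
    rw [Finset.mem_compl, not_not] at hj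
    rw [hm0 j hj]; ring
  have e2 : ∑ i ∈ S.RWᶜ, S.κ i * ((∑ j, (S.y i j : ℝ) * m j) * (S.J i t - S.J i t'))
      = ∑ i ∈ S.RWᶜ, S.κ i * ((∑ j, (S.y' i j : ℝ) * m j) * (S.J i t - S.J i t')) := by
    refine Finset.sum_congr rfl fun i hi => ?_
    have h := hm i (Finset.mem_compl.1 hi)
    have h2 : ∑ j, (S.y' i j : ℝ) * m j - ∑ j, (S.y i j : ℝ) * m j = 0 := by
      rw [← h, ← Finset.sum_sub_distrib]; exact Finset.sum_congr rfl fun j _ => by ring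
    rw [sub_eq_zero.1 h2]
  have e3 : ∑ j, m j * (S.z j t - S.z j t') = ∑ j, S.c j * (m j * (S.ξ t j - S.ξ t' j))
      + ∑ i, S.κ i * ((∑ j, (S.y' i j : ℝ) * m j) * (S.J i t - S.J i t')) := by
    have : ∑ i, S.κ i * ((∑ j, (S.y' i j : ℝ) * m j) * (S.J i t - S.J i t'))
        = ∑ j, ∑ i, m j * (S.κ i * (S.J i t - S.J i t') * S.y' i j) := by
      rw [Finset.sum_comm]
      refine Finset.sum_congr rfl fun i _ => ?_
      rw [Finset.sum_mul, Finset.mul_sum]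
      exact Finset.sum_congr rfl fun j _ => by ring
    rw [this, ← Finset.sum_add_distrib]
    refine Finset.sum_congr rfl fun j _ => ?_
    rw [← Finset.mul_sum]
    have : ∑ i, S.κ i * (S.J i t - S.J i t') * S.y' i j = ∑ i, S.κ i * S.J i t * S.y' i j - ∑ i, S.κ i * S.J i t' * S.y' i j := by
      rw [← Finset.sum_sub_distrib]; exact Finset.sum_congr rfl fun j _ => by ring
    rw [this]; unfold z; ring
  have e4 : ∑ j, m j * (S.z j t - S.z j t') = ∑ j, m j * ∑ j' ∈ S.W, S.Lam j j' * (S.z j' t - S.z j' t') := by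
    have h1 : ∀ j, S.z j t - S.z j t' = ∑ i ∈ S.RWᶜ, S.κ i * (∫ s in t'..t, S.u i s) * ((S.y' i j : ℝ) - S.y i j)
        + ∑ j' ∈ S.W, S.Lam j j' * (S.z j' t - S.z j' t') := by
      intro j
      have h2 := S.lam_sum (fun i => S.κ i * (∫ s in t'..t, S.u i s)) j
      simp only [← S.z_sub htT htT'] at h2
      rw [← h2, S.z_sub htT htT' j, Finset.sum_compl_add_sum]
    have h3 : ∑ j, m j * ∑ i ∈ S.RWᶜ, S.κ i * (∫ s in t'..t, S.u i s) * ((S.y' i j : ℝ) - S.y i j) = 0 := by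
      simp_rw [Finset.mul_sum]
      rw [Finset.sum_comm]
      refine Finset.sum_eq_zero fun i hi => ?_
      have := hm i (Finset.mem_compl.1 hi)
      calc _ = S.κ i * (∫ s in t'..t, S.u i s) * ∑ j, m j * ((S.y' i j : ℝ) - S.y i j) := by
            rw [Finset.mul_sum]; exact Finset.sum_congr rfl fun j _ => by ring
        _ = 0 := by rw [this, mul_zero]
    calc _ = ∑ j, (m j * ∑ i ∈ S.RWᶜ, S.κ i * (∫ s in t'..t, S.u i s) * ((S.y' i j : ℝ) - S.y i j)
        + m j * ∑ j' ∈ S.W, S.Lam j j' * (S.z j' t - S.z j' t')) := by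
          refine Finset.sum_congr rfl fun j _ => ?_
          rw [← mul_add, ← h1]
      _ = _ := by rw [Finset.sum_add_distrib, h3, zero_add]
  have b1 : ∑ j, m j * ∑ j' ∈ S.W, S.Lam j j' * (S.z j' t - S.z j' t') ≤ A * (S.ep t + S.ep t') := by
    rw [hA, Finset.sum_mul]
    refine Finset.sum_le_sum fun j _ => ?_
    rw [Finset.mul_sum, Finset.sum_mul]
    refine Finset.sum_le_sum fun j' hj' => ?_
    refine (le_abs_self _).trans ?_
    rw [abs_mul, abs_mul]
    have h1 := (hD t ht).2.2 j' hj'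
    have h2 := (hD t' ht').2.2 j' hj'
    have h3 : |S.z j' t - S.z j' t'| ≤ D * (S.ep t + S.ep t') := by
      refine (abs_sub _ _).trans ?_; linarith
    calc _ ≤ K * (|S.Lam j j'| * (D * (S.ep t + S.ep t'))) := by
          gcongr; exact hmK j
      _ = _ := by ring
  have b2 : - ∑ i ∈ S.RW, S.κ i * ((∑ j, (S.y' i j : ℝ) * m j) * (S.J i t - S.J i t')) ≤ A2 * (S.ep t + S.ep t') := by
    rw [← Finset.sum_neg_distrib, hA2, Finset.sum_mul]
    refine Finset.sum_le_sum fun i hi => ?_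
    refine (neg_le_abs _).trans ?_
    rw [abs_mul, abs_mul, abs_of_pos (S.hκ i)]
    have h1 := (hD t ht).2.1 i hi
    have h2 := (hD t' ht').2.1 i hi
    have h3 : |S.J i t - S.J i t'| ≤ D * (S.ep t + S.ep t') := by
      rw [abs_le]; constructor <;> nlinarith
    have h4 : |∑ j, (S.y' i j : ℝ) * m j| ≤ ∑ j, (S.y' i j : ℝ) * K := by
      refine (Finset.abs_sum_le_sum_abs _ _).trans (Finset.sum_le_sum fun j _ => ?_)
      rw [abs_mul, Nat.abs_cast]
      exact mul_le_mul_of_nonneg_left (hmK j) (Nat.cast_nonneg _)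
    have hk := S.hκ i
    calc _ ≤ S.κ i * ((∑ j, (S.y' i j : ℝ) * K) * (D * (S.ep t + S.ep t'))) := by gcongr
      _ = _ := by ring
  have e5 := Finset.sum_compl_add_sum S.RW (fun i => S.κ i * ((∑ j, (S.y' i j : ℝ) * m j) * (S.J i t - S.J i t')))
  have p1 := S.ep_pos t
  have p2 := S.ep_pos t'
  rw [e1, e2]
  nlinarith

/-- Hoffman-type bound for a subspace -/
lemma exProj (w : Fin r → Fin n → ℝ) : ∃ C : ℝ, 0 < C ∧ ∀ q : Fin n → ℝ, ∃ m : Fin n → ℝ,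
    (∀ i, ∑ j, m j * w i j = 0) ∧ ∀ B, 0 ≤ B → (∀ i, |∑ j, q j * w i j| ≤ B) → ∀ j, |q j - m j| ≤ C * B := by
  let A : (Fin n → ℝ) →ₗ[ℝ] (Fin r → ℝ) := LinearMap.pi fun i =>
    ∑ j, (w i j) • LinearMap.proj j
  have hA : ∀ q i, A q i = ∑ j, q j * w i j := by
    intro q i; simp [A, mul_comm]
  obtain ⟨N, hN⟩ := Submodule.exists_isCompl (LinearMap.ker A)
  have hker : LinearMap.ker (A.comp N.subtype) = ⊥ := by
    rw [LinearMap.ker_eq_bot']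
    intro p hp
    have h1 : (p : Fin n → ℝ) ∈ LinearMap.ker A ⊓ N := ⟨hp, p.2⟩
    rw [hN.inf_eq_bot] at h1
    exact Subtype.ext h1
  obtain ⟨K, hK, hlip⟩ := LinearMap.exists_antilipschitzWith _ hker
  refine ⟨K, hK, fun q => ?_⟩
  have hq : q ∈ LinearMap.ker A ⊔ N := by rw [hN.sup_eq_top]; trivial
  obtain ⟨m, hm, p, hp, hmp⟩ := Submodule.mem_sup.1 hq
  refine ⟨m, fun i => ?_, fun B hB hb j => ?_⟩
  · rw [← hA]; rw [LinearMap.mem_ker] at hm; rw [hm]; rfl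
  · have h1 := hlip.le_mul_dist ⟨p, hp⟩ 0
    rw [map_zero, dist_zero_right, dist_zero_right] at h1
    have h2 : A p = A q := by
      rw [← hmp, map_add, LinearMap.mem_ker.1 hm, zero_add]
    have h3 : ‖(A.comp N.subtype) ⟨p, hp⟩‖ ≤ B := by
      rw [pi_norm_le_iff_of_nonneg hB]
      intro i
      have : (A.comp N.subtype) ⟨p, hp⟩ = A q := h2
      rw [this, hA]; exact hb i
    have h4 : q j - m j = p j := by rw [← hmp]; simp
    rw [h4]
    have h5 : |p j| ≤ ‖p‖ := norm_le_pi_norm p j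
    have h6 : ‖(⟨p, hp⟩ : N)‖ = ‖p‖ := rfl
    rw [h6] at h1
    exact h5.trans (h1.trans (mul_le_mul_of_nonneg_left h3 K.2))

lemma exY : ∃ Y : ℝ, 1 ≤ Y ∧ (∀ i, ∑ j, (S.y i j : ℝ) ≤ Y) ∧ ∀ i, ∑ j, (S.y' i j : ℝ) ≤ Y := by
  have h0 : ∀ i, 0 ≤ ∑ j, (S.y i j : ℝ) + ∑ j, (S.y' i j : ℝ) := fun i => by positivity
  refine ⟨1 + ∑ i, (∑ j, (S.y i j : ℝ) + ∑ j, (S.y' i j : ℝ)), by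
    have := Finset.sum_nonneg (fun i (_ : i ∈ univ) => h0 i); linarith, fun i => ?_, fun i => ?_⟩
  all_goals
    have h1 := Finset.single_le_sum (f := fun i => ∑ j, (S.y i j : ℝ) + ∑ j, (S.y' i j : ℝ)) (fun i _ => h0 i) (Finset.mem_univ i)
    have h2 : 0 ≤ ∑ j, (S.y i j : ℝ) := by positivity
    have h3 : 0 ≤ ∑ j, (S.y' i j : ℝ) := by positivity
    linarith

lemma sumY {W : Finset (Fin n)} {η : Fin n → ℕ} {Y P : ℝ} {p : Fin n → ℝ} (hη : ∀ j ∈ W, η j = 0)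
    (hY : ∑ j, (η j : ℝ) ≤ Y) (hP : 0 ≤ P) (hp : ∀ j, j ∉ W → |p j| ≤ P) :
    |∑ j, (η j : ℝ) * p j| ≤ Y * P := by
  refine (Finset.abs_sum_le_sum_abs _ _).trans ?_
  refine le_trans ?_ (mul_le_mul_of_nonneg_right hY hP)
  rw [Finset.sum_mul]
  refine Finset.sum_le_sum fun j _ => ?_
  by_cases hj : j ∈ W
  · simp [hη j hj]
  · rw [abs_mul, Nat.abs_cast]
    exact mul_le_mul_of_nonneg_left (hp j hj) (Nat.cast_nonneg _)

open Classical in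
lemma exM (δ : ℝ) (hδ : 0 < δ) : ∃ K A : ℝ, 0 ≤ K ∧ 0 ≤ A ∧ ∀ t E, S.T0 + S.L < t → 0 < E →
    S.V (t - S.L) - S.V t ≤ E ^ 2 → (∀ s ∈ Set.Icc (t - S.L) t, ∀ j, j ∉ S.W → δ ≤ S.ξ s j) →
    ∃ m : Fin n → ℝ, (∀ j ∈ S.W, m j = 0) ∧ (∀ j, |m j| ≤ K) ∧
    (∀ i, i ∉ S.RW → ∑ j, m j * ((S.y' i j : ℝ) - S.y i j) = 0) ∧
    (∀ s ∈ Set.Icc (t - S.L) t, ∀ j, j ∉ S.W → log (S.ξ s j) ≤ K ∧ |log (S.ξ s j) - m j| ≤ A * E) ∧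
    (∀ i, i ∉ S.RW → |∑ j, (S.y i j : ℝ) * m j| ≤ K ∧ ∀ s ∈ Set.Icc (t - S.L) t,
      log (S.u i s) ≤ K ∧ |log (S.u i s) - ∑ j, (S.y i j : ℝ) * m j| ≤ A * E) := by
  obtain ⟨Cd, hCd, hdisp⟩ := S.exDisp
  obtain ⟨Cu, hCu, huv⟩ := S.exUV
  obtain ⟨Y, hY1, hYy, hYy'⟩ := S.exY
  obtain ⟨Cp, hCp, hproj⟩ := exProj (fun (i : Fin r) j => if i ∈ S.RW then (0:ℝ) else ((S.y' i j : ℝ) - S.y i j))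
  have hL := S.L_pos
  set Q := |log δ| + |log S.M| with hQ
  have hQ0 : 0 ≤ Q := by positivity
  set A1 := Cd * (1 + S.L) / δ with hA1
  have hA10 : 0 ≤ A1 := by positivity
  set A2 := Cu / exp (-(Y * Q)) + Y * A1 with hA2
  have hA20 : 0 ≤ A2 := by positivity
  set A3 := A1 + Cp * A2 with hA3
  have hA30 : 0 ≤ A3 := by positivity
  set K0 := Q + Cp * (2 * (Y * Q)) with hK0
  have hK00 : 0 ≤ K0 := by positivity
  refine ⟨Y * K0, Y * A3, by positivity, by positivity, fun t E ht hE hV hreg => ?_⟩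
  have hKY : K0 ≤ Y * K0 := by nlinarith
  have hAY : A3 ≤ Y * A3 := by nlinarith
  have hQK : Q ≤ K0 := by have : 0 ≤ Cp * (2 * (Y * Q)) := by positivity
                          linarith
  have hlogb : ∀ s ∈ Set.Icc (t - S.L) t, ∀ j, j ∉ S.W → |log (S.ξ s j)| ≤ Q := by
    intro s hs j hj
    have h1 := log_le_log hδ (hreg s hs j hj)
    have h2 := log_le_log (S.pos s j) (S.bdd s j)
    have h3 := neg_abs_le (log δ)
    have h4 := le_abs_self (log S.M)
    have h5 := abs_nonneg (log δ)
    have h6 := abs_nonneg (log S.M)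
    rw [abs_le]; constructor <;> linarith
  have hlogd : ∀ s ∈ Set.Icc (t - S.L) t, ∀ s' ∈ Set.Icc (t - S.L) t, ∀ j, j ∉ S.W →
      |log (S.ξ s j) - log (S.ξ s' j)| ≤ A1 * E := by
    intro s hs s' hs' j hj
    refine (log_sub_le hδ (hreg s hs j hj) (hreg s' hs' j hj)).trans ?_
    have h1 := hdisp (t - S.L) t E (by linarith) (by linarith) hE hV s hs s' hs' j
    rw [hA1, div_mul_eq_mul_div]
    refine div_le_div_of_nonneg_right (h1.trans (le_of_eq ?_)) hδ.le
    ring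
  -- the intermediate time
  obtain ⟨ts, hts, hslope⟩ := exists_hasDerivAt_eq_slope S.V (fun t => - S.Sd t) (a := t - 1) (b := t) (by linarith)
    (fun s hs => (S.V_deriv (by have := S.L_ge; linarith [hs.1])).continuousAt.continuousWithinAt)
    (fun s hs => S.V_deriv (by have := S.L_ge; linarith [hs.1]))
  have hSd : √(S.Sd ts) ≤ E := by
    rw [sqrt_le_left hE.le]
    have h1 := S.V_anti (a := t - S.L) (b := t - 1) (by linarith) (by have := S.L_ge; linarith)
    simp only [sub_sub_cancel, div_one] at hslope
    linarith
  have htsw : ts ∈ Set.Icc (t - S.L) t := ⟨by have := S.L_ge; linarith [hts.1], hts.2.le⟩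
  have htsw' : ∀ i, ts - S.τ i ∈ Set.Icc (t - S.L) t := fun i => by
    have h1 := S.hτm i
    have h2 := S.hτ0 i
    have h3 := hts.1
    have h4 := hts.2
    unfold L
    constructor <;> linarith
  have hlu : ∀ i, i ∉ S.RW → ∀ s ∈ Set.Icc (t - S.L) t, |log (S.u i s)| ≤ Y * Q := by
    intro i hi s hs
    rw [S.log_u]
    exact sumY (S.R0y i hi) (hYy i) hQ0 (fun j hj => hlogb s hs j hj)
  have hlv : ∀ i, i ∉ S.RW → ∀ s ∈ Set.Icc (t - S.L) t, |log (S.v i s)| ≤ Y * Q := by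
    intro i hi s hs
    rw [S.log_v]
    exact sumY (S.R0y' i hi) (hYy' i) hQ0 (fun j hj => hlogb s hs j hj)
  have hlud : ∀ i, i ∉ S.RW → ∀ s ∈ Set.Icc (t - S.L) t, ∀ s' ∈ Set.Icc (t - S.L) t,
      |log (S.u i s) - log (S.u i s')| ≤ Y * (A1 * E) := by
    intro i hi s hs s' hs'
    rw [S.log_u, S.log_u, ← Finset.sum_sub_distrib]
    simp_rw [← mul_sub]
    exact sumY (S.R0y i hi) (hYy i) (by positivity) (fun j hj => hlogd s hs s' hs' j hj)
  have hge : ∀ a : ℝ, 0 < a → |log a| ≤ Y * Q → exp (-(Y * Q)) ≤ a := by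
    intro a ha h
    rw [← le_log_iff_exp_le ha]; linarith [(abs_le.1 h).1]
  have hbal : ∀ i, i ∉ S.RW → |log (S.v i ts) - log (S.u i ts)| ≤ A2 * E := by
    intro i hi
    have h1 := log_sub_le (exp_pos (-(Y * Q))) (hge _ (S.u_pos i (ts - S.τ i)) (hlu i hi _ (htsw' i)))
      (hge _ (S.v_pos i ts) (hlv i hi _ htsw))
    have h2 : |S.u i (ts - S.τ i) - S.v i ts| / exp (-(Y * Q)) ≤ Cu / exp (-(Y * Q)) * E := by
      rw [div_mul_eq_mul_div]
      exact div_le_div_of_nonneg_right ((huv i ts).trans (mul_le_mul_of_nonneg_left hSd hCu.le)) (exp_pos _).le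
    have h3 := hlud i hi _ (htsw' i) _ htsw
    have h4 : log (S.v i ts) - log (S.u i ts) = -(log (S.u i (ts - S.τ i)) - log (S.v i ts)) +
      (log (S.u i (ts - S.τ i)) - log (S.u i ts)) := by ring
    rw [h4]
    refine (abs_add_le _ _).trans ?_
    rw [abs_neg, hA2]
    linarith
  set qh : Fin n → ℝ := fun j => if j ∈ S.W then 0 else log (S.ξ ts j) with hqh
  have hqw : ∀ i, i ∉ S.RW → ∑ j, qh j * ((S.y' i j : ℝ) - S.y i j) = log (S.v i ts) - log (S.u i ts) := by
    intro i hi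
    rw [S.log_u, S.log_v, ← Finset.sum_sub_distrib]
    refine Finset.sum_congr rfl fun j _ => ?_
    by_cases hj : j ∈ S.W
    · simp [S.R0y i hi j hj, S.R0y' i hi j hj]
    · simp only [hqh, hj, if_false]; ring
  obtain ⟨m0, hm0, hm0b⟩ := hproj qh
  have hb : ∀ B, 0 ≤ B → (∀ i, i ∉ S.RW → |log (S.v i ts) - log (S.u i ts)| ≤ B) → ∀ j, |qh j - m0 j| ≤ Cp * B := by
    intro B hB h
    refine hm0b B hB fun i => ?_
    by_cases hi : i ∈ S.RW
    · simpa [hi] using hB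
    · simp only [hi, if_false]
      rw [hqw i hi]; exact h i hi
  have hb1 := hb (A2 * E) (by positivity) hbal
  have hb2 := hb (2 * (Y * Q)) (by positivity) (fun i hi => (abs_sub _ _).trans (by
    have := hlu i hi ts htsw; have := hlv i hi ts htsw; linarith))
  set m : Fin n → ℝ := fun j => if j ∈ S.W then 0 else m0 j with hm
  have hmK : ∀ j, |m j| ≤ K0 := by
    intro j
    by_cases hj : j ∈ S.W
    · simpa [hm, hj] using hK00
    · have h1 := hb2 j
      have h2 := hlogb ts htsw j hj
      simp only [hm, hqh, hj, if_false] at h1 ⊢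
      rw [hK0]
      have := abs_sub_abs_le_abs_sub (m0 j) (log (S.ξ ts j))
      rw [abs_sub_comm] at this
      linarith
  have hlm : ∀ s ∈ Set.Icc (t - S.L) t, ∀ j, j ∉ S.W → |log (S.ξ s j) - m j| ≤ A3 * E := by
    intro s hs j hj
    have h1 := hb1 j
    have h2 := hlogd s hs ts htsw j hj
    simp only [hm, hqh, hj, if_false] at h1 ⊢
    have h3 := abs_sub_le (log (S.ξ s j)) (log (S.ξ ts j)) (m0 j)
    rw [hA3]; nlinarith
  refine ⟨m, fun j hj => by simp [hm, hj], fun j => (hmK j).trans hKY, fun i hi => ?_, fun s hs j hj => ⟨?_, ?_⟩,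
    fun i hi => ⟨?_, fun s hs => ⟨?_, ?_⟩⟩⟩
  · have h := hm0 i
    simp only [hi, if_false] at h
    rw [← h]
    refine Finset.sum_congr rfl fun j _ => ?_
    by_cases hj : j ∈ S.W
    · simp [S.w0 hi hj]
    · simp [hm, hj]
  · exact (le_abs_self _).trans ((hlogb s hs j hj).trans (hQK.trans hKY))
  · exact (hlm s hs j hj).trans (mul_le_mul_of_nonneg_right hAY hE.le)
  · exact sumY (S.R0y i hi) (hYy i) hK00 (fun j _ => hmK j)
  · exact (le_abs_self _).trans ((hlu i hi s hs).trans (by gcongr))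
  · rw [S.log_u, ← Finset.sum_sub_distrib]
    simp_rw [← mul_sub]
    refine (sumY (S.R0y i hi) (hYy i) (by positivity) (fun j hj => hlm s hs j hj)).trans (le_of_eq (by ring))

open Classical in
lemma exKey (δ : ℝ) (hδ : 0 < δ) : ∃ C ε : ℝ, 0 < C ∧ 0 < ε ∧ ∀ t E, S.T0 + S.L < t → 0 < E →
    S.V (t - S.L) - S.V t ≤ E ^ 2 → (∀ s ∈ Set.Icc (t - S.L) t, ∀ j, j ∉ S.W → δ ≤ S.ξ s j) →
    S.ep t ≤ ε → ∀ t', S.T0 + S.L < t' → S.V t - S.V t' ≤ C * E ^ 2 + C * (S.ep t' + √(S.ep t')) := by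
  obtain ⟨K, A, hK, hA, hM⟩ := S.exM δ hδ
  obtain ⟨C1, hC1, hlin⟩ := S.exLin K hK
  obtain ⟨C2, hC2, hlow⟩ := S.WV_lower
  obtain ⟨ε, hε, hup⟩ := S.WV_upper C1
  set G := exp (3 * K) * A ^ 2 with hG
  have hG0 : 0 ≤ G := by positivity
  set C3 := ∑ j ∈ S.Wᶜ, S.c j * G + ∑ i ∈ S.RWᶜ, S.κ i * (S.τ i * G) with hC3
  have hC30 : 0 ≤ C3 := add_nonneg (Finset.sum_nonneg fun j _ => by have := S.hc j; positivity)
    (Finset.sum_nonneg fun i _ => by have := S.hκ i; have := S.hτ0 i; positivity)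
  refine ⟨C1 + C2 + C3, ε, by linarith, hε, fun t E ht hE hV hreg hep t' ht' => ?_⟩
  have hL := S.L_pos
  obtain ⟨m, hmW, hmK, hmR, hmx, hmu⟩ := hM t E ht hE hV hreg
  have h1 := hlin t t' ht ht' m hmW hmK hmR
  have h2 := hlow t' ht'
  have h3 := hup t ht hep
  have htw : t ∈ Set.Icc (t - S.L) t := ⟨by linarith, le_rfl⟩
  have b1 : ∑ j ∈ S.Wᶜ, S.c j * phi (S.ξ t j) - ∑ j ∈ S.Wᶜ, S.c j * phi (S.ξ t' j) ≤
      ∑ j ∈ S.Wᶜ, S.c j * (m j * (S.ξ t j - S.ξ t' j)) + (∑ j ∈ S.Wᶜ, S.c j * G) * E ^ 2 := by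
    rw [← Finset.sum_sub_distrib, Finset.sum_mul, ← Finset.sum_add_distrib]
    refine Finset.sum_le_sum fun j hj => ?_
    rw [Finset.mem_compl] at hj
    have g1 := phi_up (S.pos t j) (hmx t htw j hj).1 (hmK j)
    have g2 := phi_tan (m j) (S.pos t' j)
    have g3 : (log (S.ξ t j) - m j) ^ 2 ≤ (A * E) ^ 2 := by
      rw [← sq_abs (log _ - _)]; exact pow_le_pow_left₀ (abs_nonneg _) (hmx t htw j hj).2 2
    have g4 := mul_le_mul_of_nonneg_left g3 (exp_pos (3 * K)).le
    have g5 : phi (S.ξ t j) - phi (S.ξ t' j) ≤ m j * (S.ξ t j - S.ξ t' j) + G * E ^ 2 := by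
      rw [hG]; linarith
    have g6 := mul_le_mul_of_nonneg_left g5 (S.hc j).le
    linarith
  have b2 : ∑ i ∈ S.RWᶜ, S.κ i * S.H i t - ∑ i ∈ S.RWᶜ, S.κ i * S.H i t' ≤
      ∑ i ∈ S.RWᶜ, S.κ i * ((∑ j, (S.y i j : ℝ) * m j) * (S.J i t - S.J i t'))
        + (∑ i ∈ S.RWᶜ, S.κ i * (S.τ i * G)) * E ^ 2 := by
    rw [← Finset.sum_sub_distrib, Finset.sum_mul, ← Finset.sum_add_distrib]
    refine Finset.sum_le_sum fun i hi => ?_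
    rw [Finset.mem_compl] at hi
    have hτ := S.hτ0 i
    have hτ' := S.hτm i
    set μ := ∑ j, (S.y i j : ℝ) * m j with hμ
    have hcu := S.u_cont i
    have hcm : Continuous (fun s => μ * S.u i s) := continuous_const.mul hcu
    have hint : ∀ a b c : ℝ, ∫ s in a..b, (μ * S.u i s + c) = μ * (∫ s in a..b, S.u i s) + (b - a) * c := by
      intro a b c
      have hcc : Continuous (fun _ : ℝ => c) := continuous_const
      rw [intervalIntegral.integral_add (hcm.intervalIntegrable _ _) (hcc.intervalIntegrable _ _),
        intervalIntegral.integral_const_mul, intervalIntegral.integral_const, smul_eq_mul]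
    have hcp : Continuous (fun s => phi (S.u i s)) := phi_cont.comp (S.u_cont i)
    have i1 : S.H i t ≤ μ * S.J i t + S.τ i * (- exp μ + G * E ^ 2) := by
      have h := intervalIntegral.integral_mono_on (μ := MeasureTheory.volume) (a := t - S.τ i) (b := t)
        (f := fun s => phi (S.u i s)) (g := fun s => μ * S.u i s + (- exp μ + G * E ^ 2)) (by linarith)
        (hcp.intervalIntegrable _ _)
        (((continuous_const.mul hcu).add continuous_const).intervalIntegrable _ _)
        (fun s hs => ?_)
      · rw [hint, sub_sub_cancel] at h
        exact h
      · have hsw : s ∈ Set.Icc (t - S.L) t := ⟨by unfold L; linarith [hs.1], hs.2⟩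
        have g1 := phi_up (S.u_pos i s) ((hmu i hi).2 s hsw).1 (hmu i hi).1
        have g3 : (log (S.u i s) - μ) ^ 2 ≤ (A * E) ^ 2 := by
          rw [← sq_abs (log _ - _)]; exact pow_le_pow_left₀ (abs_nonneg _) ((hmu i hi).2 s hsw).2 2
        have g4 := mul_le_mul_of_nonneg_left g3 (exp_pos (3 * K)).le
        rw [hG]; linarith
    have i2 : μ * S.J i t' + S.τ i * (- exp μ) ≤ S.H i t' := by
      have h := intervalIntegral.integral_mono_on (μ := MeasureTheory.volume) (a := t' - S.τ i) (b := t')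
        (g := fun s => phi (S.u i s)) (f := fun s => μ * S.u i s + (- exp μ)) (by linarith)
        (((continuous_const.mul hcu).add continuous_const).intervalIntegrable _ _)
        (hcp.intervalIntegrable _ _)
        (fun s hs => by have := phi_tan μ (S.u_pos i s); linarith)
      rw [hint, sub_sub_cancel] at h
      exact h
    have i3 : S.H i t - S.H i t' ≤ μ * (S.J i t - S.J i t') + S.τ i * G * E ^ 2 := by linarith
    have g6 := mul_le_mul_of_nonneg_left i3 (S.hκ i).le
    linarith
  have eV : ∀ t, S.V t = ∑ j ∈ S.Wᶜ, S.c j * phi (S.ξ t j) + ∑ i ∈ S.RWᶜ, S.κ i * S.H i t + S.WV t := by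
    intro t
    unfold V WV
    rw [← Finset.sum_compl_add_sum S.W, ← Finset.sum_compl_add_sum S.RW]; ring
  rw [eV t, eV t']
  have p1 := S.ep_pos t
  have p2 := S.ep_pos t'
  have p3 := sqrt_nonneg (S.ep t')
  have p4 := sq_nonneg E
  have q1 : 0 ≤ (C1 + C2) * E ^ 2 := by positivity
  have q2 : 0 ≤ (C2 + C3) * S.ep t' := by positivity
  have q3 : 0 ≤ (C1 + C3) * √(S.ep t') := by positivity
  have q4 : C3 * E ^ 2 = (∑ j ∈ S.Wᶜ, S.c j * G) * E ^ 2 + (∑ i ∈ S.RWᶜ, S.κ i * (S.τ i * G)) * E ^ 2 := by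
    rw [hC3]; ring
  linarith

def ze (j : Fin n) (t : ℝ) : ℝ :=
  ∑ j' ∈ S.W, S.Lam j j' * S.z j' t - ∑ i ∈ S.RW, S.κ i * S.J i t * S.y' i j
def F (t : ℝ) : ℝ := S.WV t + ∑ j ∈ S.Wᶜ, log (S.ξ t j) * S.ze j t
def Fd (t : ℝ) : ℝ := - ∑ i ∈ S.RW, S.κ i * gg (S.u i (t - S.τ i)) (S.v i t)
  + ∑ j ∈ S.Wᶜ, ((∑ i, S.rt i j t) / S.c j) / S.ξ t j * S.ze j t

lemma ze_deriv {t : ℝ} (ht : S.T0 < t) (j : Fin n) :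
    HasDerivAt (S.ze j) (∑ i ∈ S.RW, S.rt i j t) t := by
  have h1 : HasDerivAt (fun t => ∑ j' ∈ S.W, S.Lam j j' * S.z j' t)
      (∑ j' ∈ S.W, S.Lam j j' * ∑ i, S.κ i * S.u i t * ((S.y' i j' : ℝ) - S.y i j')) t :=
    HasDerivAt.fun_sum fun j' _ => (S.z_deriv ht j').const_mul _
  have h2 : HasDerivAt (fun t => ∑ i ∈ S.RW, S.κ i * S.J i t * S.y' i j)
      (∑ i ∈ S.RW, S.κ i * (S.u i t - S.u i (t - S.τ i)) * S.y' i j) t :=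
    HasDerivAt.fun_sum fun i _ => ((S.J_deriv i t).const_mul _).mul_const _
  refine HasDerivAt.congr_deriv (f := S.ze j) (h1.sub h2) ?_
  rw [← S.lam_sum (fun i => S.κ i * S.u i t), ← Finset.sum_sub_distrib]
  refine Finset.sum_congr rfl fun i _ => ?_
  unfold rt; ring

lemma F_deriv {t : ℝ} (ht : S.T0 < t) : HasDerivAt S.F (S.Fd t) t := by
  have h1 : HasDerivAt (fun t => ∑ j ∈ S.W, S.c j * phi (S.ξ t j))
      (∑ j ∈ S.W, log (S.ξ t j) * ∑ i, S.rt i j t) t :=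
    HasDerivAt.fun_sum fun j _ => S.cphi_deriv ht j
  have h2 : HasDerivAt (fun t => ∑ i ∈ S.RW, S.κ i * S.H i t)
      (∑ i ∈ S.RW, S.κ i * (phi (S.u i t) - phi (S.u i (t - S.τ i)))) t :=
    HasDerivAt.fun_sum fun i _ => (S.H_deriv i t).const_mul _
  have h3 : HasDerivAt (fun t => ∑ j ∈ S.Wᶜ, log (S.ξ t j) * S.ze j t)
      (∑ j ∈ S.Wᶜ, (((∑ i, S.rt i j t) / S.c j) / S.ξ t j * S.ze j t
        + log (S.ξ t j) * ∑ i ∈ S.RW, S.rt i j t)) t :=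
    HasDerivAt.fun_sum fun j _ => ((S.x_deriv ht j).log (S.pos t j).ne').mul (S.ze_deriv ht j)
  refine HasDerivAt.congr_deriv (f := S.F) ((h1.add h2).add h3) ?_
  have e := S.entropy S.RW t (S.cbRW (mono (S.ξ t)))
  rw [← Finset.sum_compl_add_sum S.W] at e
  have e2 : ∑ j ∈ S.W, log (S.ξ t j) * ∑ i, S.rt i j t
      = ∑ j ∈ S.W, log (S.ξ t j) * ∑ i ∈ S.RW, S.rt i j t := by
    refine Finset.sum_congr rfl fun j hj => ?_
    rw [S.sum_RW_of]
    intro i hi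
    simp [rt, S.R0y i hi j hj, S.R0y' i hi j hj]
  rw [e2, Finset.sum_add_distrib]
  unfold Fd
  rw [← e]; ring

lemma exZe : ∃ C : ℝ, 0 < C ∧ ∀ t, S.T0 + S.L < t → ∀ j, |S.ze j t| ≤ C * S.ep t := by
  obtain ⟨D, hD1, hD⟩ := S.exE
  have hD0 : 0 ≤ D := by linarith
  have hn : ∀ j, 0 ≤ ∑ j' ∈ S.W, |S.Lam j j'| * D + ∑ i ∈ S.RW, S.κ i * D * S.y' i j := fun j => by
    refine add_nonneg (Finset.sum_nonneg fun j' _ => by positivity) (Finset.sum_nonneg fun i _ => ?_)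
    have := S.hκ i; positivity
  refine ⟨1 + ∑ j, (∑ j' ∈ S.W, |S.Lam j j'| * D + ∑ i ∈ S.RW, S.κ i * D * S.y' i j),
    by have := Finset.sum_nonneg (fun j (_ : j ∈ univ) => hn j); linarith, fun t ht j => ?_⟩
  obtain ⟨_, hJ, hz⟩ := hD t ht
  have h1 := Finset.single_le_sum (f := fun j => ∑ j' ∈ S.W, |S.Lam j j'| * D + ∑ i ∈ S.RW, S.κ i * D * S.y' i j)
    (fun j _ => hn j) (Finset.mem_univ j)
  have hp := S.ep_pos t
  refine le_trans ?_ (mul_le_mul_of_nonneg_right (h1.trans (by linarith)) hp.le)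
  unfold ze
  refine (abs_sub _ _).trans ?_
  rw [add_mul, Finset.sum_mul, Finset.sum_mul]
  refine add_le_add ((Finset.abs_sum_le_sum_abs _ _).trans (Finset.sum_le_sum fun j' hj' => ?_))
    ((Finset.abs_sum_le_sum_abs _ _).trans (Finset.sum_le_sum fun i hi => ?_))
  · rw [abs_mul, mul_assoc]
    exact mul_le_mul_of_nonneg_left (hz j' hj') (abs_nonneg _)
  · have hk := S.hκ i
    rw [abs_of_nonneg (mul_nonneg (mul_nonneg hk.le (hJ i hi).1) (Nat.cast_nonneg _))]
    have := mul_le_mul_of_nonneg_left (hJ i hi).2 (mul_nonneg hk.le (Nat.cast_nonneg (S.y' i j) : (0:ℝ) ≤ _))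
    linarith

lemma exF (δ : ℝ) (hδ : 0 < δ) : ∃ C ε : ℝ, 0 < C ∧ 0 < ε ∧ ∀ t, S.T0 + S.L < t →
    (∀ j, j ∉ S.W → δ ≤ S.ξ t j) → S.ep t ≤ ε →
    S.ep t ≤ - S.F t ∧ - S.F t ≤ C * (S.ep t + √(S.ep t)) ∧ S.Fd t / (- S.F t) ≤ C * √(S.Sd t) := by
  obtain ⟨C1, hC1, h1⟩ := S.exZe
  obtain ⟨C2, hC2, h2⟩ := S.exXd
  obtain ⟨C3, hC3, h3⟩ := S.WV_lower
  set Q := |log δ| + |log S.M| with hQ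
  have hQ0 : 0 ≤ Q := by positivity
  set P := ∑ _j ∈ S.Wᶜ, Q * C1 with hP
  have hP0 : 0 ≤ P := Finset.sum_nonneg fun _ _ => by positivity
  set R := ∑ _j ∈ S.Wᶜ, C2 / δ * C1 with hR
  have hR0 : 0 ≤ R := Finset.sum_nonneg fun _ _ => by positivity
  obtain ⟨ε, hε, h4⟩ := S.WV_upper (P + 1)
  refine ⟨C3 + P + R, ε, by linarith, hε, fun t ht hreg hep => ?_⟩
  have hp := S.ep_pos t
  have hsp := sqrt_nonneg (S.ep t)
  have hL := S.L_pos
  have hlog : ∀ j, j ∉ S.W → |log (S.ξ t j)| ≤ Q := by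
    intro j hj
    have h1 := log_le_log hδ (hreg j hj)
    have h2 := log_le_log (S.pos t j) (S.bdd t j)
    have h3 := neg_abs_le (log δ)
    have h4 := le_abs_self (log S.M)
    have h5 := abs_nonneg (log δ)
    have h6 := abs_nonneg (log S.M)
    rw [abs_le]; constructor <;> linarith
  have hs : |∑ j ∈ S.Wᶜ, log (S.ξ t j) * S.ze j t| ≤ P * S.ep t := by
    refine (Finset.abs_sum_le_sum_abs _ _).trans ?_
    rw [hP, Finset.sum_mul]
    refine Finset.sum_le_sum fun j hj => ?_
    rw [Finset.mem_compl] at hj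
    rw [abs_mul, mul_assoc]
    exact mul_le_mul (hlog j hj) (h1 t ht j) (abs_nonneg _) hQ0
  have hs' := abs_le.1 hs
  have hw := h4 t ht hep
  have hw' := h3 t ht
  have hF : S.ep t ≤ - S.F t := by unfold F; linarith
  have hFp : 0 < - S.F t := by linarith
  refine ⟨hF, ?_, ?_⟩
  · unfold F
    have q2 : 0 ≤ (C3 + R) * S.ep t := by positivity
    have q3 : 0 ≤ (P + R) * √(S.ep t) := by positivity
    linarith
  · rw [div_le_iff₀ hFp]
    have hSd := sqrt_nonneg (S.Sd t)
    have k1 : ∑ j ∈ S.Wᶜ, ((∑ i, S.rt i j t) / S.c j) / S.ξ t j * S.ze j t ≤ R * √(S.Sd t) * S.ep t := by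
      rw [hR, Finset.sum_mul, Finset.sum_mul]
      refine Finset.sum_le_sum fun j hj => ?_
      rw [Finset.mem_compl] at hj
      refine (le_abs_self _).trans ?_
      rw [abs_mul, abs_div, abs_of_pos (S.pos t j)]
      have a1 : |(∑ i, S.rt i j t) / S.c j| / S.ξ t j ≤ C2 * √(S.Sd t) / δ :=
        div_le_div₀ (by positivity) (h2 t j) hδ (hreg j hj)
      calc _ ≤ C2 * √(S.Sd t) / δ * (C1 * S.ep t) := mul_le_mul a1 (h1 t ht j) (abs_nonneg _) (by positivity)
        _ = _ := by ring
    have k2 : 0 ≤ ∑ i ∈ S.RW, S.κ i * gg (S.u i (t - S.τ i)) (S.v i t) :=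
      Finset.sum_nonneg fun i _ => mul_nonneg (S.hκ i).le (gg_nonneg (S.u_pos _ _) (S.v_pos _ _))
    have k3 : R * √(S.Sd t) * S.ep t ≤ R * √(S.Sd t) * (- S.F t) := mul_le_mul_of_nonneg_left hF (by positivity)
    have k4 : 0 ≤ (C3 + P) * √(S.Sd t) * (- S.F t) := by positivity
    unfold Fd
    linarith

lemma V_lim : ∃ Vi : ℝ, Tendsto S.V atTop (nhds Vi) ∧ ∀ t, S.T0 < t → Vi ≤ S.V t := by
  obtain ⟨C, hC⟩ := S.V_bdd
  have hanti : Antitone (fun t => S.V (max t (S.T0 + 1))) := fun a b hab =>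
    S.V_anti (lt_of_lt_of_le (by linarith) (le_max_right _ _)) (max_le_max_right _ hab)
  have h := tendsto_atTop_ciInf hanti ⟨C, by rintro _ ⟨t, rfl⟩; exact hC _⟩
  have h2 : Tendsto S.V atTop (nhds (⨅ t, S.V (max t (S.T0 + 1)))) := by
    refine h.congr' ?_
    filter_upwards [eventually_ge_atTop (S.T0 + 1)] with t ht
    rw [max_eq_left ht]
  refine ⟨_, h2, fun t ht => ?_⟩
  refine le_of_tendsto h2 ?_
  filter_upwards [eventually_ge_atTop t] with s hs
  exact S.V_anti ht hs

lemma exDelta {W : Finset (Fin n)} {θ : Fin n → ℝ} (hp : ∀ j, j ∉ W → 0 < θ j) :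
    ∃ δ : ℝ, 0 < δ ∧ ∀ j, j ∉ W → 2 * δ ≤ θ j := by
  have h : ∀ᶠ δ : ℝ in nhdsWithin 0 (Set.Ioi 0), ∀ j, j ∉ W → 2 * δ ≤ θ j := by
    rw [eventually_all]
    intro j
    by_cases hj : j ∈ W
    · exact Eventually.of_forall fun δ h => absurd hj h
    · have := Ioo_mem_nhdsGT (half_pos (hp j hj))
      filter_upwards [this] with δ hδ _
      linarith [hδ.2]
  obtain ⟨δ, h1, h2⟩ := (h.and self_mem_nhdsWithin).exists
  exact ⟨δ, h2, h1⟩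

theorem noLimit (tN : ℕ → ℝ) (htN : Tendsto tN atTop atTop) (θ : Fin n → ℝ)
    (hlim : ∀ j, Tendsto (fun N => S.ξ (tN N) j) atTop (nhds (θ j)))
    (h0 : ∀ j ∈ S.W, θ j = 0) (hp : ∀ j, j ∉ S.W → 0 < θ j) : False := by
  obtain ⟨Vi, hVi, hVge⟩ := S.V_lim
  obtain ⟨δ, hδ, hδθ⟩ := exDelta hp
  obtain ⟨C1, ε1, hC1, hε1, hkey⟩ := S.exKey δ hδ
  obtain ⟨C2, ε2, hC2, hε2, hF⟩ := S.exF δ hδ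
  obtain ⟨Cd, hCd, hdisp⟩ := S.exDisp
  have hL := S.L_pos
  have hepl : Tendsto (fun N => S.ep (tN N)) atTop (nhds 0) := by
    have h := tendsto_finsetSum S.W (fun j _ => hlim j)
    rw [Finset.sum_eq_zero h0] at h
    exact h
  have hep2 : ∀ C : ℝ, Tendsto (fun N => C * (S.ep (tN N) + √(S.ep (tN N)))) atTop (nhds 0) := by
    intro C
    have h := (hepl.add ((continuous_sqrt.tendsto 0).comp hepl)).const_mul C
    simpa using h
  set ρ := min δ (min ε1 ε2 / (n + 1)) with hρ
  have hρ0 : 0 < ρ := lt_min hδ (div_pos (lt_min hε1 hε2) (by positivity))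
  have hreg : ∀ s, (∀ j, |S.ξ s j - θ j| ≤ ρ) →
      (∀ j, j ∉ S.W → δ ≤ S.ξ s j) ∧ S.ep s ≤ ε1 ∧ S.ep s ≤ ε2 := by
    intro s hs
    have hh : S.ep s ≤ min ε1 ε2 := by
      have h1 : S.ep s ≤ ∑ _j ∈ S.W, ρ := by
        refine Finset.sum_le_sum fun j hj => ?_
        have := (abs_le.1 (hs j)).2
        rw [h0 j hj] at this; linarith
      rw [Finset.sum_const, nsmul_eq_mul] at h1
      have h2 : (S.W.card : ℝ) ≤ n + 1 := by
        have := Finset.card_le_univ S.W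
        rw [Fintype.card_fin] at this
        have : (S.W.card : ℝ) ≤ n := by exact_mod_cast this
        linarith
      have h3 : ρ ≤ min ε1 ε2 / (n + 1) := min_le_right _ _
      rw [le_div_iff₀ (by positivity)] at h3
      nlinarith
    refine ⟨fun j hj => ?_, hh.trans (min_le_left _ _), hh.trans (min_le_right _ _)⟩
    have h1 := (abs_le.1 (hs j)).1
    have h2 := hδθ j hj
    have h3 : ρ ≤ δ := min_le_left _ _
    linarith
  have hkey' : ∀ t E, S.T0 + S.L < t → 0 < E → S.V (t - S.L) - S.V t ≤ E ^ 2 →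
      (∀ s ∈ Set.Icc (t - S.L) t, ∀ j, |S.ξ s j - θ j| ≤ ρ) → S.V t - Vi ≤ C1 * E ^ 2 := by
    intro t E ht hE hV hr
    have h1 := hkey t E ht hE hV (fun s hs => (hreg s (hr s hs)).1)
      (hreg t (hr t ⟨by linarith, le_rfl⟩)).2.1
    have h2 : Tendsto (fun N => S.V t - S.V (tN N)) atTop (nhds (S.V t - Vi)) :=
      (hVi.comp htN).const_sub _
    have h3 := (hep2 C1).const_add (C1 * E ^ 2)
    rw [add_zero] at h3
    refine le_of_tendsto_of_tendsto h2 h3 ?_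
    filter_upwards [htN.eventually (eventually_gt_atTop (S.T0 + S.L))] with N hN
    exact h1 _ hN
  set q := C1 / (1 + C1) with hq
  have hq0 : 0 < q := by positivity
  have hq1 : q < 1 := by rw [hq, div_lt_one (by positivity)]; linarith
  have hqC : C1 * (1 - q) = q := by rw [hq]; field_simp; ring
  set R := √q with hR
  have hR0 : 0 < R := sqrt_pos.2 hq0
  have hR2 : R ^ 2 = q := sq_sqrt hq0.le
  have hR1 : R < 1 := by nlinarith
  set C5 := Cd * (1 + S.L) with hC5
  have hC50 : 0 < C5 := by positivity
  set E := ρ * (1 - R) / (2 * C5) with hE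
  have hE0 : 0 < E := div_pos (mul_pos hρ0 (by linarith)) (by positivity)
  have hEC : C5 * E = ρ / 2 * (1 - R) := by rw [hE]; field_simp
  have hEn : ∀ k : ℕ, 0 < R ^ k * E := fun k => by positivity
  -- starting time
  obtain ⟨t0, ht0, hVt0, hxt0⟩ : ∃ t0, S.T0 + S.L < t0 ∧ S.V t0 - Vi ≤ E ^ 2 ∧
      ∀ j, |S.ξ t0 j - θ j| ≤ ρ / 2 := by
    have e1 := htN.eventually (eventually_gt_atTop (S.T0 + S.L))
    have e2 := (hVi.comp htN).eventually (ge_mem_nhds (show Vi < Vi + E ^ 2 by have := pow_pos hE0 2; linarith))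
    have e3 : ∀ᶠ N in atTop, ∀ j, |S.ξ (tN N) j - θ j| ≤ ρ / 2 := by
      rw [eventually_all]
      intro j
      have := (hlim j).eventually (Metric.closedBall_mem_nhds (θ j) (half_pos hρ0))
      filter_upwards [this] with N hN
      rwa [Real.dist_eq] at hN
    obtain ⟨N, h1, h2, h3⟩ := (e1.and (e2.and e3)).exists
    refine ⟨tN N, h1, ?_, h3⟩
    have : S.V (tN N) ≤ Vi + E ^ 2 := h2
    linarith
  have hmain : ∀ k : ℕ, S.V (t0 + k * S.L) - Vi ≤ (R ^ k * E) ^ 2 ∧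
      ∀ s ∈ Set.Icc t0 (t0 + k * S.L), ∀ j, |S.ξ s j - θ j| ≤ ρ / 2 + ρ / 2 * (1 - R ^ k) := by
    intro k
    induction k with
    | zero =>
      refine ⟨by simpa using hVt0, fun s hs j => ?_⟩
      have : s = t0 := by
        obtain ⟨h1, h2⟩ := hs
        simp at h2; linarith
      rw [this]; simpa using hxt0 j
    | succ k ih =>
      obtain ⟨ih1, ih2⟩ := ih
      have hkL : (0:ℝ) ≤ k * S.L := by positivity
      set a := t0 + k * S.L with ha
      have hb : t0 + ((k + 1 : ℕ) : ℝ) * S.L = a + S.L := by push_cast; rw [ha]; ring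
      rw [hb]
      have haT : S.T0 < a := by linarith
      have hVb := hVge (a + S.L) (by linarith)
      have hpk : 0 < R ^ k := by positivity
      have hall : ∀ s ∈ Set.Icc t0 (a + S.L), ∀ j, |S.ξ s j - θ j| ≤ ρ / 2 + ρ / 2 * (1 - R ^ (k + 1)) := by
        intro s hs j
        rcases le_total s a with h | h
        · refine (ih2 s ⟨hs.1, h⟩ j).trans ?_
          have : R ^ (k + 1) ≤ R ^ k := pow_le_pow_of_le_one hR0.le hR1.le (Nat.le_succ k)
          have := mul_le_mul_of_nonneg_left this hρ0.le
          linarith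
        · have h1 := hdisp a (a + S.L) (R ^ k * E) haT (by linarith) (hEn k) (by linarith) s ⟨h, hs.2⟩
            a ⟨le_rfl, by linarith⟩ j
          have h2 := ih2 a ⟨by linarith, le_rfl⟩ j
          have h3 := abs_sub_le (S.ξ s j) (S.ξ a j) (θ j)
          have h4 : Cd * (1 + (a + S.L - a)) * (R ^ k * E) = ρ / 2 * (1 - R) * R ^ k := by
            rw [← hEC, hC5]; ring
          rw [h4] at h1
          rw [pow_succ]
          linarith
      refine ⟨?_, hall⟩
      by_contra hcon
      push Not at hcon
      have e0 : (R ^ (k + 1) * E) ^ 2 = q * (R ^ k * E) ^ 2 := by rw [← hR2]; ring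
      rw [e0] at hcon
      have hE' : 0 < √(1 - q) * (R ^ k * E) := mul_pos (sqrt_pos.2 (by linarith)) (hEn k)
      have e1 : (√(1 - q) * (R ^ k * E)) ^ 2 = (1 - q) * (R ^ k * E) ^ 2 := by
        rw [mul_pow, sq_sqrt (by linarith)]
      have h := hkey' (a + S.L) _ (by linarith) hE' (by rw [e1, add_sub_cancel_right]; linarith)
        (fun s hs j => by
          rw [add_sub_cancel_right] at hs
          refine (hall s ⟨by linarith [hs.1], hs.2⟩ j).trans ?_
          have : 0 ≤ ρ * R ^ (k + 1) := by positivity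
          linarith)
      rw [e1, ← mul_assoc, hqC] at h
      linarith
  have harch : ∀ s, ∃ k : ℕ, s ≤ t0 + k * S.L := by
    intro s
    obtain ⟨k, hk⟩ := exists_nat_ge ((s - t0) / S.L)
    rw [div_le_iff₀ hL] at hk
    exact ⟨k, by linarith⟩
  have hgood : ∀ s, t0 ≤ s → S.ep s ≤ - S.F s ∧ - S.F s ≤ C2 * (S.ep s + √(S.ep s)) ∧
      S.Fd s / (- S.F s) ≤ C2 * √(S.Sd s) := by
    intro s hs
    obtain ⟨k, hk⟩ := harch s
    have hg := hreg s (fun j => ((hmain k).2 s ⟨hs, hk⟩ j).trans (by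
      have : 0 ≤ ρ * R ^ k := by positivity
      linarith))
    exact hF s (by linarith) hg.1 hg.2.2
  have hFpos : ∀ s, t0 ≤ s → 0 < - S.F s := fun s hs => (S.ep_pos s).trans_le (hgood s hs).1
  have hfd : ∀ s, t0 ≤ s → HasDerivAt (fun s => - log (- S.F s)) (S.Fd s / (- S.F s)) s := by
    intro s hs
    have h := ((S.F_deriv (t := s) (by linarith)).neg.log (hFpos s hs).ne').neg
    refine HasDerivAt.congr_deriv (f := fun s => - log (- S.F s)) h ?_
    rw [neg_div, neg_neg]; rfl
  set G := C2 * (1 + S.L) * E / (1 - R) with hG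
  have hGe : C2 * (1 + S.L) * E = G * (1 - R) := by
    rw [hG]; rw [div_mul_cancel₀]; linarith
  have hG0 : 0 < G := div_pos (by positivity) (by linarith)
  have hf : ∀ k : ℕ, ∀ s ∈ Set.Icc t0 (t0 + k * S.L), - log (- S.F s) ≤ - log (- S.F t0) + G * (1 - R ^ k) := by
    intro k
    induction k with
    | zero =>
      intro s hs
      have : s = t0 := by
        obtain ⟨h1, h2⟩ := hs
        simp at h2; linarith
      rw [this]; simp
    | succ k ih =>
      intro s hs
      have hkL : (0:ℝ) ≤ k * S.L := by positivity
      have hm := (hmain k).1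
      set a := t0 + k * S.L with ha
      have hb : t0 + ((k + 1 : ℕ) : ℝ) * S.L = a + S.L := by push_cast; rw [ha]; ring
      rw [hb] at hs
      rcases le_total s a with h | h
      · refine (ih s ⟨hs.1, h⟩).trans ?_
        have : R ^ (k + 1) ≤ R ^ k := pow_le_pow_of_le_one hR0.le hR1.le (Nat.le_succ k)
        have := mul_le_mul_of_nonneg_left this hG0.le
        linarith
      · have h1 := S.step (f := fun s => - log (- S.F s)) (f' := fun s => S.Fd s / (- S.F s)) hC2.le
          (show S.T0 < a by linarith) h (hEn k) (fun t ht => hfd t (by linarith [ht.1]))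
          (fun t ht => (hgood t (by linarith [ht.1])).2.2) (by have := hVge s (by linarith); linarith)
        have h2 := ih a ⟨by linarith, le_rfl⟩
        have h3 : C2 * (1 + (s - a)) * (R ^ k * E) ≤ C2 * (1 + S.L) * (R ^ k * E) := by
          refine mul_le_mul_of_nonneg_right (mul_le_mul_of_nonneg_left ?_ hC2.le) (hEn k).le
          linarith [hs.2]
        have h4 : C2 * (1 + S.L) * (R ^ k * E) = G * (1 - R) * R ^ k := by rw [← hGe]; ring
        rw [pow_succ]
        linarith
  set c0 := exp (log (- S.F t0) - G) with hc0
  have hc00 : 0 < c0 := exp_pos _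
  have hlow : ∀ s, t0 ≤ s → c0 ≤ - S.F s := by
    intro s hs
    obtain ⟨k, hk⟩ := harch s
    have h := hf k s ⟨hs, hk⟩
    rw [hc0, ← le_log_iff_exp_le (hFpos s hs)]
    have : 0 ≤ G * R ^ k := by positivity
    linarith
  have : c0 ≤ 0 := by
    refine ge_of_tendsto (hep2 C2) ?_
    filter_upwards [htN.eventually (eventually_ge_atTop t0)] with N hN
    exact (hlow _ hN).trans (hgood _ hN).2.1
  linarith

end Sys

lemma mono_le_bd0 (M : ℝ) (hM : 1 ≤ M) (η : Fin n → ℕ) :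
    ∃ B : ℝ, 1 ≤ B ∧ ∀ x : Fin n → ℝ, (∀ j, 0 ≤ x j) → (∀ j, x j ≤ M) →
      ∀ j, η j ≠ 0 → mono x η ≤ B * x j := by
  refine ⟨M ^ (∑ j, η j), one_le_pow₀ hM, fun x hx hb j hj => ?_⟩
  unfold mono
  rw [← Finset.prod_pow_eq_pow_sum, ← Finset.mul_prod_erase _ _ (Finset.mem_univ j),
    ← Finset.mul_prod_erase _ (fun i => M ^ η i) (Finset.mem_univ j)]
  have h1 : ∏ i ∈ univ.erase j, x i ^ η i ≤ ∏ i ∈ univ.erase j, M ^ η i :=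
    Finset.prod_le_prod (fun j _ => pow_nonneg (hx j) _)
      (fun j _ => pow_le_pow_left₀ (hx j) (hb j) _)
  have h2 : x j ^ η j ≤ M ^ η j * x j := by
    obtain ⟨k, hk⟩ := Nat.exists_eq_succ_of_ne_zero hj
    rw [hk, pow_succ]
    have : x j ^ k ≤ M ^ (k+1) :=
      (pow_le_pow_left₀ (hx j) (hb j) _).trans (pow_le_pow_right₀ hM (by omega))
    exact mul_le_mul_of_nonneg_right this (hx j)
  calc _ ≤ (M ^ η j * x j) * ∏ i ∈ univ.erase j, M ^ η i := by
        apply mul_le_mul h2 h1 (Finset.prod_nonneg fun i _ => pow_nonneg (hx i) _)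
        exact mul_nonneg (by positivity) (hx j)
    _ = _ := by ring

lemma sol_pos {y y' : Fin r → Fin n → ℕ} {k τ : Fin r → ℝ} {τm : ℝ} (hk : ∀ i, 0 < k i)
    (hτm : ∀ i, τ i ≤ τm) (hτm0 : 0 ≤ τm) {x : ℝ → Fin n → ℝ} (hx : IsSolution y y' k τ τm x)
    (hxpos : PosInit τm x) {M : ℝ} (hM : 1 ≤ M) (hb : ∀ t ∈ Set.Ici (-τm), ∀ j, x t j ≤ M)
    (t : ℝ) (ht : 0 ≤ t) (j : Fin n) : 0 < x t j := by
  obtain ⟨hnn, hcont, hd⟩ := hx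
  choose B hB1 hB using fun i => mono_le_bd0 M hM (y i)
  set K := ∑ i, k i * (B i * (y i j : ℝ)) with hK
  have hd' : ∀ s, 0 < s → HasDerivAt (fun s => x s j) (∑ i, k i * (mono (x (s - τ i)) (y i) * (y' i j : ℝ)
      - mono (x s) (y i) * (y i j : ℝ))) s := fun s hs => (hasDerivAt_pi.1 (hd s hs)) j
  have hmem : ∀ s, 0 ≤ s → s ∈ Set.Ici (-τm) := fun s hs => by
    show -τm ≤ s
    linarith
  have hlow : ∀ s, 0 < s → -(K * x s j) ≤ ∑ i, k i * (mono (x (s - τ i)) (y i) * (y' i j : ℝ)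
      - mono (x s) (y i) * (y i j : ℝ)) := by
    intro s hs
    rw [hK, Finset.sum_mul, ← Finset.sum_neg_distrib]
    refine Finset.sum_le_sum fun i _ => ?_
    have hm : s - τ i ∈ Set.Ici (-τm) := by
      show -τm ≤ s - τ i
      linarith [hτm i]
    have h1 : 0 ≤ mono (x (s - τ i)) (y i) := Finset.prod_nonneg fun j _ => pow_nonneg (hnn _ hm j) _
    have h2 : mono (x s) (y i) * (y i j : ℝ) ≤ B i * (y i j : ℝ) * x s j := by
      by_cases h : y i j = 0
      · simp [h]
      · have := hB i (x s) (hnn s (hmem s hs.le)) (hb s (hmem s hs.le)) j h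
        have := mul_le_mul_of_nonneg_right this (Nat.cast_nonneg (y i j) : (0:ℝ) ≤ _)
        linarith
    have h3 : 0 ≤ mono (x (s - τ i)) (y i) * (y' i j : ℝ) := by positivity
    have := mul_le_mul_of_nonneg_left (show -(B i * (y i j : ℝ) * x s j) ≤
      mono (x (s - τ i)) (y i) * (y' i j : ℝ) - mono (x s) (y i) * (y i j : ℝ) by linarith) (hk i).le
    linarith
  have hg : ∀ s, 0 < s → HasDerivAt (fun s => exp (K * s) * x s j)
      (exp (K * s) * (K * 1) * x s j + exp (K * s) * (∑ i, k i * (mono (x (s - τ i)) (y i) * (y' i j : ℝ)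
      - mono (x s) (y i) * (y i j : ℝ)))) s := fun s hs =>
    (((hasDerivAt_id s).const_mul K).exp).mul (hd' s hs)
  have hmono : MonotoneOn (fun s => exp (K * s) * x s j) (Set.Ici 0) := by
    apply monotoneOn_of_deriv_nonneg (convex_Ici _)
    · refine ContinuousOn.mul (Continuous.continuousOn (by fun_prop)) ?_
      exact ((continuous_apply j).comp_continuousOn hcont).mono (fun s hs => hmem s hs)
    · rw [interior_Ici]; exact fun s hs => (hg s hs).differentiableAt.differentiableWithinAt
    · rw [interior_Ici]
      intro s hs
      rw [(hg s hs).deriv]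
      have := mul_le_mul_of_nonneg_left (hlow s hs) (exp_pos (K * s)).le
      linarith
  have h := hmono (Set.mem_Ici.2 (le_refl (0:ℝ))) (Set.mem_Ici.2 ht) ht
  simp only [mul_zero, exp_zero, one_mul] at h
  have h0 := hxpos 0 ⟨by linarith, le_rfl⟩ j
  exact pos_of_mul_pos_right (h0.trans_le h) (exp_pos _).le

lemma cb_sum {y y' : Fin r → Fin n → ℕ} {κ : Fin r → ℝ}
    (h : ∀ η : Fin n → ℕ, ∑ i ∈ univ.filter (fun i => y i = η), κ i = ∑ i ∈ univ.filter (fun i => y' i = η), κ i)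
    (f : (Fin n → ℕ) → ℝ) : ∑ i, κ i * f (y i) = ∑ i, κ i * f (y' i) := by
  classical
  have h1 := Finset.sum_fiberwise_of_maps_to (s := univ) (t := univ.image y ∪ univ.image y') (g := y)
    (fun i _ => by simp) (fun i => κ i * f (y i))
  have h2 := Finset.sum_fiberwise_of_maps_to (s := univ) (t := univ.image y ∪ univ.image y') (g := y')
    (fun i _ => by simp) (fun i => κ i * f (y' i))
  rw [← h1, ← h2]
  refine Finset.sum_congr rfl fun η _ => ?_
  have e1 : ∑ i ∈ univ with y i = η, κ i * f (y i) = (∑ i ∈ univ with y i = η, κ i) * f η := by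
    rw [Finset.sum_mul]
    refine Finset.sum_congr rfl fun i hi => ?_
    rw [(Finset.mem_filter.1 hi).2]
  have e2 : ∑ i ∈ univ with y' i = η, κ i * f (y' i) = (∑ i ∈ univ with y' i = η, κ i) * f η := by
    rw [Finset.sum_mul]
    refine Finset.sum_congr rfl fun i hi => ?_
    rw [(Finset.mem_filter.1 hi).2]
  rw [e1, e2, h η]

lemma exLam {w : Fin r → Fin n → ℝ} {W : Finset (Fin n)} {RW : Finset (Fin r)}
    (h : ∀ a : Fin r → ℝ, (∀ j ∈ W, ∑ i ∈ RW, a i * w i j = 0) → ∀ j, ∑ i ∈ RW, a i * w i j = 0) :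
    ∃ Lam : Fin n → Fin n → ℝ, ∀ i ∈ RW, ∀ j, w i j = ∑ j' ∈ W, Lam j j' * w i j' := by
  classical
  let Kf : Fin n → ((Fin r → ℝ) →ₗ[ℝ] ℝ) := fun j => ∑ i ∈ RW, (w i j) • LinearMap.proj i
  have hK : ∀ j a, Kf j a = ∑ i ∈ RW, a i * w i j := by
    intro j a; simp [Kf, mul_comm]
  let Lf : Fin n → ((Fin r → ℝ) →ₗ[ℝ] ℝ) := fun j => if j ∈ W then Kf j else 0
  have key : ∀ j, ∃ c : Fin n → ℝ, ∑ j', c j' • Lf j' = Kf j := by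
    intro j
    rw [← Submodule.mem_span_range_iff_exists_fun]
    apply mem_span_of_iInf_ker_le_ker
    intro a ha
    rw [Submodule.mem_iInf] at ha
    rw [LinearMap.mem_ker, hK]
    refine h a (fun j' hj' => ?_) j
    have := ha j'
    rw [LinearMap.mem_ker] at this
    simp only [Lf, hj', if_true] at this
    rw [← hK, this]
  choose Lam hLam using key
  refine ⟨Lam, fun i hi j => ?_⟩
  have h1 := congrArg (fun g : (Fin r → ℝ) →ₗ[ℝ] ℝ => g (Pi.single i 1)) (hLam j)
  have h2 : ∀ j, Kf j (Pi.single i 1) = w i j := by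
    intro j
    rw [hK, Finset.sum_eq_single_of_mem i hi]
    · simp
    · intro b _ hb; simp [hb]
  simp only [LinearMap.sum_apply, LinearMap.smul_apply, smul_eq_mul, h2] at h1
  rw [← h1]
  have h3 : ∀ j', Lam j j' * (Lf j') (Pi.single i 1) = if j' ∈ W then Lam j j' * w i j' else 0 := by
    intro j'
    by_cases hj : j' ∈ W
    · simp only [Lf, hj, if_true, h2]
    · simp [Lf, hj]
  rw [Finset.sum_congr rfl (fun j' _ => h3 j'), Finset.sum_ite_mem, Finset.univ_inter]

lemma inj_of_vertex {l : ℕ} {y y' : Fin r → Fin n → ℕ} {Sp : Fin l → Set (Fin n)} {grp : Fin r → Fin l}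
    (hcomb : IsCombination y y' Sp grp) {W : Set (Fin n)} (hWSc : W ∩ interSpecies Sp = ∅)
    (hIII : ∀ p, W ∩ Sp p = ∅ ∨ VertexType (stoichOn y y' (Rgrp grp p)) (W ∩ Sp p))
    {RW : Finset (Fin r)} (hRW : ∀ i ∈ RW, ∃ j ∈ W, y i j ≠ 0) (a : Fin r → ℝ)
    (ha : ∀ j ∈ W, ∑ i ∈ RW, a i * ((y' i j : ℝ) - y i j) = 0) (j : Fin n) :
    ∑ i ∈ RW, a i * ((y' i j : ℝ) - y i j) = 0 := by
  have h0 : ∀ p, (fun j => ∑ i ∈ RW with grp i = p, a i * ((y' i j : ℝ) - y i j)) = 0 := by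
    intro p
    rcases hIII p with hp | hp
    · have : RW.filter (fun i => grp i = p) = ∅ := by
        rw [Finset.filter_eq_empty_iff]
        intro i hi hg
        obtain ⟨j, hj, hy⟩ := hRW i hi
        have h1 := hcomb.2 i j (Or.inl hy)
        rw [hg] at h1
        have : j ∈ W ∩ Sp p := ⟨hj, h1⟩
        rw [hp] at this
        exact this
      rw [this]; funext j; simp
    · apply hp
      · have e : (fun j => ∑ i ∈ RW with grp i = p, a i * ((y' i j : ℝ) - y i j))
            = ∑ i ∈ RW with grp i = p, a i • (fun j => ((y' i j : ℝ) - y i j)) := by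
          funext j; simp
        rw [e]
        refine Submodule.sum_mem _ fun i hi => Submodule.smul_mem _ _ (Submodule.subset_span ⟨i, ?_, rfl⟩)
        simp only [Rgrp, Finset.mem_filter, Finset.mem_univ, true_and]
        exact (Finset.mem_filter.1 hi).2
      · intro j hj
        rw [← ha j hj.1]
        refine Finset.sum_subset (Finset.filter_subset _ _) fun i hi hi' => ?_
        have hg : grp i ≠ p := fun hg => hi' (Finset.mem_filter.2 ⟨hi, hg⟩)
        have hn : j ∉ Sp (grp i) := fun hs => by
          have : j ∈ W ∩ interSpecies Sp := ⟨hj.1, grp i, p, hg, hs, hj.2⟩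
          rw [hWSc] at this
          exact this
        have h1 : y i j = 0 := by
          by_contra h
          exact hn (hcomb.2 i j (Or.inl h))
        have h2 : y' i j = 0 := by
          by_contra h
          exact hn (hcomb.2 i j (Or.inr h))
        simp [h1, h2]
  rw [← Finset.sum_fiberwise RW grp]
  exact Finset.sum_eq_zero fun p _ => congrFun (h0 p) j

lemma mono_div (x b : Fin n → ℝ) (η : Fin n → ℕ) : mono (fun j => x j / b j) η = mono x η / mono b η := by
  unfold mono
  rw [← Finset.prod_div_distrib]
  exact Finset.prod_congr rfl fun j _ => div_pow _ _ _

end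

end DPf

theorem stmt7 {n r l : ℕ} (y y' : Fin r → Fin n → ℕ)
    (k τ : Fin r → ℝ) (τm : ℝ)
    (hk : ∀ i, 0 < k i) (hτ : ∀ i, 0 ≤ τ i) (hτm : ∀ i, τ i ≤ τm) (hτm0 : 0 ≤ τm)
    (hCB : ComplexBalancedOn y y' k Finset.univ)
    (Sp : Fin l → Set (Fin n)) (grp : Fin r → Fin l)
    (hcomb : IsCombination y y' Sp grp)
    (hsubCB : ∀ p, ComplexBalancedOn y y' k (Rgrp grp p))
    (h2d : ∀ p, Module.finrank ℝ (stoichOn y y' (Rgrp grp p)) = 2)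
    (W : Set (Fin n)) (hW : Semilocking y y' Finset.univ W)
    (hWSc : W ∩ interSpecies Sp = ∅)
    (hcaseIII : (∀ p, W ∩ Sp p = ∅ ∨ (Semilocking y y' (Rgrp grp p) (W ∩ Sp p) ∧
        VertexType (stoichOn y y' (Rgrp grp p)) (W ∩ Sp p))) ∧
      ∃ p, W ∩ Sp p = ∅)
    (hWcv : (Wᶜ \ Wcn Sp W).Nonempty)
    (x : ℝ → Fin n → ℝ) (hx : IsSolution y y' k τ τm x)
    (hxpos : PosInit τm x) (hxbdd : BoundedSol τm x)
    (θ : ℝ → Fin n → ℝ) (hθ : OmegaLimitPt τm x θ) :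
    ¬ OnBoundary τm W θ := by
  classical
  intro hOB
  obtain ⟨xb, hxb, hbal⟩ := hCB
  obtain ⟨M0, hM0⟩ := hxbdd
  obtain ⟨hθc, hθnn, tN, htN, hconv⟩ := hθ
  set M1 : ℝ := max M0 1 with hM1
  have hM11 : 1 ≤ M1 := le_max_right _ _
  have hb1 : ∀ t ∈ Set.Ici (-τm), ∀ j, x t j ≤ M1 := fun t ht j =>
    (le_abs_self _).trans ((norm_le_pi_norm (x t) j).trans ((hM0 t ht).trans (le_max_left _ _)))
  have hpos : ∀ t, 0 ≤ t → ∀ j, 0 < x t j := DPf.sol_pos hk hτm hτm0 hx hxpos hM11 hb1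
  have hmem : ∀ s : ℝ, 0 ≤ s → s ∈ Set.Ici (-τm) := fun s hs => Set.mem_Ici.2 (by linarith)
  have hmax : ∀ t : ℝ, 0 ≤ max t 1 := fun t => zero_le_one.trans (le_max_right _ _)
  set Wf : Finset (Fin n) := univ.filter (fun j => j ∈ W) with hWf
  have hWmem : ∀ j, j ∈ Wf ↔ j ∈ W := fun j => by simp [hWf]
  set RW : Finset (Fin r) := univ.filter (fun i => ∃ j ∈ W, y i j ≠ 0) with hRWd
  have hRW : ∀ i, i ∈ RW ↔ ∃ j ∈ W, y i j ≠ 0 := fun i => by simp [hRWd]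
  have hκ : ∀ i, 0 < k i * mono xb (y i) := fun i => mul_pos (hk i) (DPf.mono_pos hxb _)
  have hcb := DPf.cb_sum (κ := fun i => k i * mono xb (y i)) hbal
  have hiff : ∀ i, (∃ j ∈ W, y' i j ≠ 0) ↔ ∃ j ∈ W, y i j ≠ 0 := by
    have h := hcb (fun η => if ∃ j ∈ W, η j ≠ 0 then 1 else 0)
    have hle : ∀ i ∈ (univ : Finset (Fin r)),
        (k i * mono xb (y i)) * (if ∃ j ∈ W, y' i j ≠ 0 then (1:ℝ) else 0)
        ≤ (k i * mono xb (y i)) * (if ∃ j ∈ W, y i j ≠ 0 then (1:ℝ) else 0) := by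
      intro i hi
      refine mul_le_mul_of_nonneg_left ?_ (hκ i).le
      by_cases h1 : ∃ j ∈ W, y' i j ≠ 0
      · rw [if_pos h1, if_pos (hW.2 i hi h1)]
      · rw [if_neg h1]; split_ifs <;> norm_num
    have h2 := (Finset.sum_eq_sum_iff_of_le hle).1 h.symm
    intro i
    refine ⟨hW.2 i (mem_univ i), fun h3 => ?_⟩
    by_contra h4
    have h5 := h2 i (mem_univ i)
    rw [if_neg h4, if_pos h3] at h5
    have := hκ i
    linarith
  obtain ⟨Lam, hLam⟩ := DPf.exLam (w := fun i j => ((y' i j : ℝ) - y i j)) (W := Wf) (RW := RW)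
    (fun a ha j => DPf.inj_of_vertex hcomb hWSc
      (fun p => (hcaseIII.1 p).imp id (fun h => h.2)) (fun i hi => (hRW i).1 hi) a
      (fun j hj => ha j ((hWmem j).2 hj)) j)
  have hM2 : ∀ j, M1 / xb j ≤ ∑ j, M1 / xb j := fun j =>
    Finset.single_le_sum (f := fun j => M1 / xb j)
      (fun j _ => div_nonneg (by linarith) (hxb j).le) (mem_univ j)
  have hM2n : 0 ≤ ∑ j, M1 / xb j := Finset.sum_nonneg fun j _ => div_nonneg (by linarith) (hxb j).le
  let S : DPf.Sys n r :=
    { y := y, y' := y', κ := fun i => k i * mono xb (y i), τ := τ, c := xb, τm := τm, T0 := 1 + τm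
      M := 1 + ∑ j, M1 / xb j
      ξ := fun t j => x (max t 1) j / xb j
      W := Wf, RW := RW, Lam := Lam
      hκ := hκ, hτ0 := hτ, hτm := hτm, hτm0 := hτm0, hc := hxb
      hM := by linarith
      cont := by
        intro j
        refine Continuous.div_const ?_ _
        have h1 : Continuous (fun t : ℝ => x (max t 1)) :=
          hx.2.1.comp_continuous (by fun_prop) (fun t => hmem _ (hmax t))
        exact (continuous_apply j).comp h1
      pos := fun t j => div_pos (hpos _ (hmax t) j) (hxb j)
      bdd := fun t j => by
        have h1 := div_le_div_of_nonneg_right (hb1 _ (hmem _ (hmax t)) j) (hxb j).le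
        have h2 := hM2 j
        linarith
      dde := by
        intro t ht j
        have h1 := (hasDerivAt_pi.1 (hx.2.2 t (by linarith))) j
        have h2 := h1.div_const (xb j)
        have h3 : (fun t => x (max t 1) j / xb j) =ᶠ[nhds t] fun t => x t j / xb j := by
          filter_upwards [eventually_gt_nhds (show (1:ℝ) < t by linarith)] with s hs
          rw [max_eq_left hs.le]
        refine HasDerivAt.congr_deriv (h2.congr_of_eventuallyEq h3) ?_
        congr 1
        refine Finset.sum_congr rfl fun i _ => ?_
        rw [DPf.mono_div, DPf.mono_div, max_eq_left (show 1 ≤ t - τ i by linarith [hτm i]),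
          max_eq_left (show 1 ≤ t by linarith)]
        have := (DPf.mono_pos hxb (y i)).ne'
        field_simp
      cb := hcb
      Wne := by
        obtain ⟨j, hj⟩ := hW.1
        exact ⟨j, (hWmem j).2 hj⟩
      R0y := by
        intro i hi j hj
        by_contra h
        exact hi ((hRW i).2 ⟨j, (hWmem j).1 hj, h⟩)
      R0y' := by
        intro i hi j hj
        by_contra h
        exact hi ((hRW i).2 ((hiff i).1 ⟨j, (hWmem j).1 hj, h⟩))
      RWy := by
        intro i hi
        obtain ⟨j, hj, h⟩ := (hRW i).1 hi
        exact ⟨j, (hWmem j).2 hj, h⟩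
      RWy' := by
        intro i hi
        obtain ⟨j, hj, h⟩ := (hiff i).2 ((hRW i).1 hi)
        exact ⟨j, (hWmem j).2 hj, h⟩
      hLam := hLam }
  have h00 : (0:ℝ) ∈ Set.Icc (-τm) 0 := ⟨by linarith, le_rfl⟩
  have hlim : Tendsto (fun N => x (tN N)) atTop (nhds (θ 0)) := by
    rw [Metric.tendsto_atTop]
    intro ε hε
    obtain ⟨N₀, h⟩ := hconv ε hε
    refine ⟨N₀, fun N hN => ?_⟩
    have := h N hN 0 h00
    rw [add_zero] at this
    rwa [dist_eq_norm]
  refine S.noLimit tN htN (fun j => θ 0 j / xb j) (fun j => ?_) (fun j hj => ?_) (fun j hj => ?_)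
  · have h1 := ((tendsto_pi_nhds.1 hlim) j).div_const (xb j)
    refine h1.congr' ?_
    filter_upwards [htN.eventually (eventually_ge_atTop 1)] with N hN
    show _ = x (max (tN N) 1) j / xb j
    rw [max_eq_left hN]
  · show θ 0 j / xb j = 0
    rw [hOB.1 0 h00 j ((hWmem j).1 hj), zero_div]
  · have hj' : j ∉ W := fun h => hj ((hWmem j).2 h)
    exact div_pos (lt_of_le_of_ne (hθnn 0 h00 j) (hOB.2 0 h00 j hj').symm) (hxb j)
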